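/- arXiv:1910.07651 — 5 statements merged into one kernel-verified Lean document; each statement's English description precedes it below -/
import Mathlib

section
/- Let V be a finite set of positive integers. A set partition π of V has the property that every block of π induces a connected subgraph of the Ferrers graph Γ_V (i.e., π belongs to the bond lattice Π_{Γ_V}) if and only if every block of π with more than one element has an odd minimum element and an even maximum element. -/
open Finset

/-- The Ferrers graph on vertex set `V ⊆ ℕ`: edges `{u,v}` with `u < v`, `u` odd, `v` even. -/
def ferrers (V : Finset ℕ) : SimpleGraph ℕ :=
  SimpleGraph.fromRel (fun u v => u ∈ V ∧ v ∈ V ∧ u < v ∧ Odd u ∧ Even v)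

/-- A partition of `V` is a bond partition if each block induces a connected subgraph. -/
def IsBond (V : Finset ℕ) (P : Finpartition V) : Prop :=
  ∀ B ∈ P.parts, ((ferrers V).induce (B : Set ℕ)).Connected

/-- `u` is a (strict) descendant of `v` in the graph `G` rooted (componentwise) at `r`. -/
def DescOf {α : Type*} (G : SimpleGraph α) (r v u : α) : Prop :=
  u ≠ v ∧ G.Reachable u r ∧ ∀ p : G.Walk u r, v ∈ p.support

/-- `F` is an increasing-decreasing (ID) forest. -/
def IsIDForest (V : Finset ℕ) (F : SimpleGraph {x // x ∈ V}) : Prop :=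
  F.IsAcyclic ∧
  ∀ r v : {x // x ∈ V}, F.Reachable v r → (∀ u, F.Reachable v u → (u : ℕ) ≤ (r : ℕ)) →
    (Odd (v : ℕ) →
      (∀ u, DescOf F r v u → (v : ℕ) < (u : ℕ)) ∧
      (∀ u, F.Adj v u → DescOf F r v u → Even (u : ℕ))) ∧
    (Even (v : ℕ) →
      (∀ u, DescOf F r v u → (u : ℕ) < (v : ℕ)) ∧
      (∀ u, F.Adj v u → DescOf F r v u → Odd (u : ℕ)))

/-- `T` is an increasing-decreasing (ID) tree. -/
def IsIDTree (V : Finset ℕ) (T : SimpleGraph {x // x ∈ V}) : Prop :=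
  T.Connected ∧ IsIDForest V T

/-- A D-permutation on `A`. -/
def IsDPerm (A : Finset ℕ) (σ : Equiv.Perm {x // x ∈ A}) : Prop :=
  ∀ i : {x // x ∈ A}, (Odd (i : ℕ) → (i : ℕ) ≤ (σ i : ℕ)) ∧ (Even (i : ℕ) → (σ i : ℕ) ≤ (i : ℕ))

/-- A D-cycle on `A`: a D-permutation which is a single cycle covering `A`. -/
def IsDCycle (A : Finset ℕ) (σ : Equiv.Perm {x // x ∈ A}) : Prop :=
  IsDPerm A σ ∧ ∀ x y : {x // x ∈ A}, σ.SameCycle x y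

/-- The number of cycles (orbits, fixed points included) of a permutation. -/
noncomputable def cycleCount {α : Type*} (σ : Equiv.Perm α) : ℕ :=
  Nat.card (Quotient (⟨σ.SameCycle, Equiv.Perm.SameCycle.equivalence σ⟩ : Setoid α))

/-- A Dumont permutation on `A` (intended for `A = [2m]`). -/
def IsDumontPerm (A : Finset ℕ) (σ : Equiv.Perm {x // x ∈ A}) : Prop :=
  ∀ i : {x // x ∈ A}, (Even (i : ℕ) → (σ i : ℕ) < (i : ℕ)) ∧ (Odd (i : ℕ) → (i : ℕ) ≤ (σ i : ℕ))

/-- A Dumont derangement on `A` (intended for `A = [2m]`). -/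
def IsDumontDerangement (A : Finset ℕ) (σ : Equiv.Perm {x // x ∈ A}) : Prop :=
  ∀ i : {x // x ∈ A}, (Even (i : ℕ) → (σ i : ℕ) < (i : ℕ)) ∧ (Odd (i : ℕ) → (i : ℕ) < (σ i : ℕ))

/-- The Genocchi number `g n`: the number of Dumont permutations on `[2n-2]`. -/
noncomputable def genocchi (n : ℕ) : ℕ :=
  Nat.card {σ : Equiv.Perm {x // x ∈ Finset.Icc 1 (2 * n - 2)} // IsDumontPerm _ σ}

/-- The median Genocchi number `h n`: the number of Dumont derangements on `[2n+2]`. -/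
noncomputable def medianGenocchi (n : ℕ) : ℕ :=
  Nat.card {σ : Equiv.Perm {x // x ∈ Finset.Icc 1 (2 * n + 2)} // IsDumontDerangement _ σ}

theorem ferrers_adj_of_lt {V : Finset ℕ} {u v : ℕ} (huv : u < v) :
    (ferrers V).Adj u v ↔ u ∈ V ∧ v ∈ V ∧ Odd u ∧ Even v := by
  rw [ferrers, SimpleGraph.fromRel_adj]
  constructor
  · rintro ⟨-, ⟨hu, hv, -, ho, he⟩ | ⟨-, -, hlt, -⟩⟩
    · exact ⟨hu, hv, ho, he⟩
    · omega
  · rintro ⟨hu, hv, ho, he⟩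
    exact ⟨huv.ne, Or.inl ⟨hu, hv, huv, ho, he⟩⟩

/-- In a connected induced subgraph on more than one vertex, every vertex has a neighbour. -/
theorem exists_adj_of_induce_connected {α : Type*} {G : SimpleGraph α} {B : Finset α}
    (hG : (G.induce (B : Set α)).Connected) (hB : 1 < B.card) {a : α} (ha : a ∈ B) :
    ∃ b ∈ B, G.Adj a b := by
  have : Nontrivial (B : Set α) :=
    Set.nontrivial_coe_sort.2 (Finset.one_lt_card_iff_nontrivial.1 hB)
  obtain ⟨b, hb⟩ := hG.preconnected.exists_adj_of_nontrivial ⟨a, ha⟩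
  exact ⟨b, b.2, hb⟩

theorem odd_min'_and_even_max'_of_ferrers_induce_connected {V B : Finset ℕ}
    (hG : ((ferrers V).induce (B : Set ℕ)).Connected) (hB : B.Nonempty) (hcard : 1 < B.card) :
    Odd (B.min' hB) ∧ Even (B.max' hB) := by
  constructor
  · obtain ⟨b, hb, hadj⟩ := exists_adj_of_induce_connected hG hcard (B.min'_mem hB)
    exact ((ferrers_adj_of_lt ((B.min'_le b hb).lt_of_ne hadj.ne)).1 hadj).2.2.1
  · obtain ⟨b, hb, hadj⟩ := exists_adj_of_induce_connected hG hcard (B.max'_mem hB)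
    exact ((ferrers_adj_of_lt ((B.le_max' b hb).lt_of_ne hadj.ne')).1 hadj.symm).2.2.2

theorem ferrers_induce_connected_of_odd_min'_of_even_max' {V B : Finset ℕ} (hBV : B ⊆ V)
    (hB : B.Nonempty) (hmin : Odd (B.min' hB)) (hmax : Even (B.max' hB)) :
    ((ferrers V).induce (B : Set ℕ)).Connected := by
  have adj : ∀ u v : (B : Set ℕ), (u : ℕ) < v → Odd (u : ℕ) → Even (v : ℕ) →
      ((ferrers V).induce (B : Set ℕ)).Adj u v := fun u v huv ho he =>
    (ferrers_adj_of_lt huv).2 ⟨hBV u.2, hBV v.2, ho, he⟩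
  have ne : ∀ {a b : ℕ}, Odd a → Even b → a ≠ b := by
    rintro a _ ho he rfl
    exact Nat.not_even_iff_odd.2 ho he
  let m : (B : Set ℕ) := ⟨B.min' hB, B.min'_mem hB⟩
  let M : (B : Set ℕ) := ⟨B.max' hB, B.max'_mem hB⟩
  rw [SimpleGraph.connected_iff_exists_forall_reachable]
  refine ⟨m, fun w => ?_⟩
  rcases Nat.even_or_odd (w : ℕ) with hw | hw
  · exact (adj m w ((B.min'_le w w.2).lt_of_ne (ne hmin hw)) hmin hw).reachable
  · have hmM := adj m M ((B.min'_le _ M.2).lt_of_ne (ne hmin hmax)) hmin hmax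
    have hwM := adj w M ((B.le_max' w w.2).lt_of_ne (ne hw hmax)) hw hmax
    exact hmM.reachable.trans hwM.symm.reachable

/-- A partition of a finite set `V` of positive integers belongs to the bond lattice of the
Ferrers graph `Γ_V` iff every block with more than one element has odd minimum and even
maximum. -/
theorem stmt1 (V : Finset ℕ) (hV : ∀ v ∈ V, 0 < v) (P : Finpartition V) :
    IsBond V P ↔ ∀ B ∈ P.parts, ∀ hB : B.Nonempty,
      1 < B.card → Odd (B.min' hB) ∧ Even (B.max' hB) := by
  constructor
  · exact fun h B hBP hB hcard =>
      odd_min'_and_even_max'_of_ferrers_induce_connected (h B hBP) hB hcard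
  · intro h B hBP
    have hB : B.Nonempty := P.nonempty_of_mem_parts hBP
    by_cases hcard : 1 < B.card
    · obtain ⟨hmin, hmax⟩ := h B hBP hB hcard
      exact ferrers_induce_connected_of_odd_min'_of_even_max' (P.le hBP) hB hmin hmax
    · obtain ⟨a, rfl⟩ := Finset.card_eq_one.1
        (le_antisymm (not_lt.1 hcard) hB.card_pos)
      rw [Finset.coe_singleton]
      exact SimpleGraph.Connected.of_subsingleton
end

section
/- Let V be a finite set of positive integers and let π be a partition in the bond lattice Π_{Γ_V} of the Ferrers graph Γ_V. Then (−1)^{|V| − b(π)} · μ(0̂, π) equals the number of ID forests with vertex set V whose set of tree vertex sets is exactly the set of blocks of π, where b(π) is the number of blocks of π, 0̂ is the partition of V into singletons, and μ is the Möbius function of Π_{Γ_V}. (In particular |μ(0̂, π)| equals this number of ID forests.) -/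
open Finset

open scoped Classical

/-- A root-free description of ID forests: every edge joins an odd vertex to a larger even one,
and no path `a - b - c - d` with `a`, `c` odd has both `a < c` and `b < d`. -/
def IsLocalIDForest (V : Finset ℕ) (F : SimpleGraph {x // x ∈ V}) : Prop :=
  F.IsAcyclic ∧
  (∀ u v : {x // x ∈ V}, F.Adj u v → (Odd (u : ℕ) ∧ Even (v : ℕ) ∧ (u : ℕ) < v) ∨
    (Odd (v : ℕ) ∧ Even (u : ℕ) ∧ (v : ℕ) < u)) ∧
  ∀ a b c d : {x // x ∈ V}, F.Adj a b → F.Adj b c → F.Adj c d → Odd (a : ℕ) → Odd (c : ℕ) →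
    (a : ℕ) < c → (d : ℕ) ≤ b

lemma DescOf.of_adj {α : Type*} {G : SimpleGraph α} {r v c d : α} (hc : DescOf G r v c)
    (hadj : G.Adj c d) (hd : d ≠ v) : DescOf G r v d := by
  refine ⟨hd, hadj.symm.reachable.trans hc.2.1, fun p => ?_⟩
  have := hc.2.2 (SimpleGraph.Walk.cons hadj p)
  rw [SimpleGraph.Walk.support_cons, List.mem_cons] at this
  exact this.resolve_left hc.1.symm

lemma SimpleGraph.IsAcyclic.descOf_or_descOf {α : Type*} {G : SimpleGraph α} (hG : G.IsAcyclic)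
    {r u v : α} (hadj : G.Adj u v) (hr : G.Reachable u r) : DescOf G r v u ∨ DescOf G r u v := by
  obtain ⟨p, hp⟩ := hr.exists_isPath
  have unique : ∀ {x : α} (q : G.Walk x r), q.IsPath → ∀ q' : G.Walk x r, ∀ y ∈ q.support,
      y ∈ q'.support := by
    intro x q hq q' y hy
    have := (hG.subsingleton_path x r).elim ⟨q, hq⟩ q'.toPath
    rw [show q = q'.toPath.1 from congrArg Subtype.val this] at hy
    exact q'.support_toPath_subset_support hy
  by_cases hv : v ∈ p.support
  · exact Or.inl ⟨hadj.ne, hr, fun q => unique p hp q v hv⟩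
  · refine Or.inr ⟨hadj.ne', hadj.symm.reachable.trans hr, fun q => ?_⟩
    exact unique (SimpleGraph.Walk.cons hadj.symm p) (by simp [hp, hv]) q u (by simp)

lemma IsIDForest.isLocalIDForest {V : Finset ℕ} {F : SimpleGraph {x // x ∈ V}}
    (hF : IsIDForest V F) : IsLocalIDForest V F := by
  obtain ⟨hac, hF⟩ := hF
  have root : ∀ v : {x // x ∈ V}, ∃ r, F.Reachable v r ∧
      ∀ u, F.Reachable v u → (u : ℕ) ≤ (r : ℕ) := by
    intro v
    obtain ⟨r, hr, hmax⟩ := Finset.exists_max_image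
      (Finset.univ.filter fun u => F.Reachable v u) (fun u => (u : ℕ)) ⟨v, by simp⟩
    exact ⟨r, by simpa using hr, fun u hu => hmax u (by simpa using hu)⟩
  refine ⟨hac, fun u v huv => ?_, fun a b c d hab hbc hcd ha hc hlt => ?_⟩
  · obtain ⟨r, hr, hmax⟩ := root u
    have hvr := huv.symm.reachable.trans hr
    have hu := hF r u hr hmax
    have hv := hF r v hvr fun w hw => hmax w (huv.reachable.trans hw)
    rcases hac.descOf_or_descOf huv hr with h | h
    · rcases Nat.even_or_odd (v : ℕ) with hp | hp
      · exact Or.inl ⟨(hv.2 hp).2 u huv.symm h, hp, (hv.2 hp).1 u h⟩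
      · exact Or.inr ⟨hp, (hv.1 hp).2 u huv.symm h, (hv.1 hp).1 u h⟩
    · rcases Nat.even_or_odd (u : ℕ) with hp | hp
      · exact Or.inr ⟨(hu.2 hp).2 v huv h, hp, (hu.2 hp).1 v h⟩
      · exact Or.inl ⟨hp, (hu.1 hp).2 v huv h, (hu.1 hp).1 v h⟩
  · by_contra! hbd
    obtain ⟨r, hr, hmax⟩ := root b
    have hb := hF r b hr hmax
    have hcr := hF r c (hbc.symm.reachable.trans hr) fun w hw => hmax w (hbc.reachable.trans hw)
    rcases hac.descOf_or_descOf hbc hr with h | h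
    · have := (hcr.1 hc).1 a (h.of_adj hab.symm (by rintro rfl; exact lt_irrefl _ hlt))
      omega
    · have hdb := h.of_adj hcd (by rintro rfl; exact lt_irrefl _ hbd)
      rcases Nat.even_or_odd (b : ℕ) with hp | hp
      · have := (hb.2 hp).1 d hdb
        omega
      · have := (hb.1 hp).2 c hbc h
        exact absurd hc (Nat.not_odd_iff_even.2 this)

/-- The descent condition along a directed edge `w → x`: the other neighbours of `x` lie strictly
on the same side of `w` as prescribed by the parity of `w`. -/
def EdgeDescends {V : Finset ℕ} (F : SimpleGraph {x // x ∈ V}) (w x : {x // x ∈ V}) : Prop :=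
  ∀ d, F.Adj x d → d ≠ w → (Even (w : ℕ) → (d : ℕ) < w) ∧ (Odd (w : ℕ) → (w : ℕ) < d)

lemma IsLocalIDForest.edgeDescends_step {V : Finset ℕ} {F : SimpleGraph {x // x ∈ V}}
    (hF : IsLocalIDForest V F) {w x d : {x // x ∈ V}} (hwx : F.Adj w x) (h : EdgeDescends F w x)
    (hxd : F.Adj x d) (hd : d ≠ w) : EdgeDescends F x d := by
  intro e hde hne
  have h1 := hF.2.1 w x hwx
  have h2 := hF.2.1 x d hxd
  have h3 := hF.2.1 d e hde
  have h4 := h d hxd hd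
  have hne' : (e : ℕ) ≠ x := fun h => hne (Subtype.ext h)
  have h5 := hF.2.2 e d x w hde.symm hxd.symm hwx.symm
  have h6 := hF.2.2 w x d e hwx hxd hde
  grind

lemma IsLocalIDForest.path_spec {V : Finset ℕ} {F : SimpleGraph {x // x ∈ V}}
    (hF : IsLocalIDForest V F) {x u : {x // x ∈ V}} (q : F.Walk x u) :
    ∀ {w : {x // x ∈ V}} (hwx : F.Adj w x), EdgeDescends F w x →
      (SimpleGraph.Walk.cons hwx q).IsPath →
      ((Even (w : ℕ) → (x : ℕ) ≤ u ∧ (u : ℕ) < w) ∧ (Odd (w : ℕ) → (u : ℕ) ≤ x ∧ (w : ℕ) < u)) ∧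
      ∀ v ∈ (SimpleGraph.Walk.cons hwx q).support, v ≠ u →
        (Even (v : ℕ) → (u : ℕ) < v) ∧ (Odd (v : ℕ) → (v : ℕ) < u) := by
  induction q with
  | nil =>
    rename_i x
    intro w hwx _ _
    have := hF.2.1 w x hwx
    refine ⟨by grind, fun v hv hne => ?_⟩
    simp at hv
    grind
  | cons hxd q ih =>
    rename_i x d u
    intro w hwx hD hp
    have hdw : d ≠ w := by
      rintro rfl
      have := (SimpleGraph.Walk.cons_isPath_iff _ _).1 hp
      simp at this
    obtain ⟨ih1, ih2⟩ := ih hxd (hF.edgeDescends_step hwx hD hxd hdw)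
      ((SimpleGraph.Walk.cons_isPath_iff _ _).1 hp).1
    have h1 := hF.2.1 w x hwx
    have h2 := hF.2.1 x d hxd
    have h4 := hD d hxd hdw
    have key : (Even (w : ℕ) → (x : ℕ) ≤ u ∧ (u : ℕ) < w) ∧
        (Odd (w : ℕ) → (u : ℕ) ≤ x ∧ (w : ℕ) < u) := by grind
    refine ⟨key, fun v hv hne => ?_⟩
    rw [SimpleGraph.Walk.support_cons, List.mem_cons] at hv
    rcases hv with rfl | hv
    · exact ⟨fun h => (key.1 h).2, fun h => (key.2 h).2⟩
    · exact ih2 v hv hne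

lemma IsLocalIDForest.isIDForest {V : Finset ℕ} {F : SimpleGraph {x // x ∈ V}}
    (hF : IsLocalIDForest V F) : IsIDForest V F := by
  refine ⟨hF.1, fun r v hvr hmax => ?_⟩
  have key : ∀ u, DescOf F r v u →
      (Even (v : ℕ) → (u : ℕ) < v) ∧ (Odd (v : ℕ) → (v : ℕ) < u) := by
    rintro u ⟨huv, hur, hdesc⟩
    obtain ⟨p, hp⟩ := hur.symm.exists_isPath
    have hv : v ∈ p.support := by simpa using hdesc p.reverse
    cases p with
    | nil => simp at hv; exact absurd hv.symm huv
    | cons hrx q =>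
      rename_i x
      refine (hF.path_spec q hrx (fun d hxd hdr => ?_) hp).2 v hv huv.symm
      have h1 := hmax d (hvr.trans (hrx.reachable.trans hxd.reachable))
      have h2 := hmax x (hvr.trans hrx.reachable)
      have h3 := hF.2.1 r x hrx
      have h4 : (d : ℕ) ≠ r := fun h => hdr (Subtype.ext h)
      grind
  refine ⟨fun hv => ⟨fun u hu => (key u hu).2 hv, fun u hu _ => ?_⟩,
    fun hv => ⟨fun u hu => (key u hu).1 hv, fun u hu _ => ?_⟩⟩
  · have := hF.2.1 v u hu
    grind
  · have := hF.2.1 v u hu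
    grind

lemma isIDForest_iff_isLocalIDForest {V : Finset ℕ} {F : SimpleGraph {x // x ∈ V}} :
    IsIDForest V F ↔ IsLocalIDForest V F :=
  ⟨IsIDForest.isLocalIDForest, IsLocalIDForest.isIDForest⟩

lemma IsLocalIDForest.anti {V : Finset ℕ} {F G : SimpleGraph {x // x ∈ V}} (h : F ≤ G)
    (hG : IsLocalIDForest V G) : IsLocalIDForest V F :=
  ⟨hG.1.anti h, fun u v huv => hG.2.1 u v (h huv),
    fun a b c d hab hbc hcd => hG.2.2 a b c d (h hab) (h hbc) (h hcd)⟩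

lemma mem_of_reachable {α : Type*} {G : SimpleGraph α} {B : Set α}
    (hB : ∀ u v, G.Adj u v → u ∈ B → v ∈ B) {u v : α} (h : G.Reachable u v) (hu : u ∈ B) :
    v ∈ B := by
  obtain ⟨p⟩ := h
  induction p with
  | nil => exact hu
  | cons huw _ ih => exact ih (hB _ _ huw hu)

lemma IsLocalIDForest.adj_of_reachable {V : Finset ℕ} {F : SimpleGraph {x // x ∈ V}}
    (hF : IsLocalIDForest V F) {B : Set {x // x ∈ V}} (hB : ∀ u v, F.Adj u v → u ∈ B → v ∈ B)
    {s m : {x // x ∈ V}} (hm : m ∈ B) (hsB : ∀ u ∈ B, (s : ℕ) ≤ u)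
    (hmB : ∀ u ∈ B, (u : ℕ) ≤ m) (hm2 : Even (m : ℕ)) (hsm : s ≠ m)
    (h : F.Reachable m s) : F.Adj m s := by
  obtain ⟨p, hp⟩ := h.exists_isPath
  cases p with
  | nil => exact absurd rfl hsm
  | cons hmx q =>
    rename_i x
    have hx := hB _ _ hmx hm
    have key := (hF.path_spec q hmx (fun d hxd hdm => ?_) hp).1.1 hm2
    · have : x = s := Subtype.ext (le_antisymm key.1 (hsB x hx))
      exact this ▸ hmx
    · have h1 := hmB d (hB _ _ hxd hx)
      have h4 : (d : ℕ) ≠ m := fun h => hdm (Subtype.ext h)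
      grind

lemma IsLocalIDForest.sup_edge {V : Finset ℕ} {F : SimpleGraph {x // x ∈ V}}
    (hF : IsLocalIDForest V F) {B : Set {x // x ∈ V}} (hB : ∀ u v, F.Adj u v → u ∈ B → v ∈ B)
    {s m : {x // x ∈ V}} (hs : s ∈ B) (hm : m ∈ B) (hsB : ∀ u ∈ B, (s : ℕ) ≤ u)
    (hmB : ∀ u ∈ B, (u : ℕ) ≤ m) (hs2 : Odd (s : ℕ)) (hm2 : Even (m : ℕ))
    (hadj : ¬ F.Adj s m) : IsLocalIDForest V (F ⊔ SimpleGraph.edge s m) := by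
  have hsm : s ≠ m := by rintro rfl; exact Nat.not_even_iff_odd.2 hs2 hm2
  have hG : ∀ u v, (F ⊔ SimpleGraph.edge s m).Adj u v ↔
      F.Adj u v ∨ (u = s ∧ v = m) ∨ (u = m ∧ v = s) := by
    intro u v
    rw [SimpleGraph.sup_adj, SimpleGraph.edge_adj]
    grind
  have hGB : ∀ u v, (F ⊔ SimpleGraph.edge s m).Adj u v → u ∈ B → v ∈ B := by
    intro u v huv hu
    rcases (hG u v).1 huv with h | ⟨rfl, rfl⟩ | ⟨rfl, rfl⟩
    · exact hB u v h hu
    · exact hm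
    · exact hs
  have hodd : ∀ u v, (F ⊔ SimpleGraph.edge s m).Adj u v →
      (Odd (u : ℕ) ∧ Even (v : ℕ) ∧ (u : ℕ) < v) ∨
        (Odd (v : ℕ) ∧ Even (u : ℕ) ∧ (v : ℕ) < u) := by
    have hlt : (s : ℕ) < m := lt_of_le_of_ne (hsB m hm) fun h => hsm (Subtype.ext h)
    intro u v huv
    rcases (hG u v).1 huv with h | ⟨rfl, rfl⟩ | ⟨rfl, rfl⟩
    · exact hF.2.1 u v h
    · exact Or.inl ⟨hs2, hm2, hlt⟩
    · exact Or.inr ⟨hs2, hm2, hlt⟩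
  refine ⟨hF.1.sup_edge_of_not_reachable fun h => hadj
    (hF.adj_of_reachable hB hm hsB hmB hm2 hsm h.symm).symm, hodd,
    fun a b c d hab hbc hcd ha hc hac => ?_⟩
  have hb2 : Even (b : ℕ) := by have := hodd a b hab; grind
  have hd2 : Even (d : ℕ) := by have := hodd c d hcd; grind
  by_cases hcs : c = s
  · subst hcs
    have := hsB a (hGB _ _ hab.symm (hGB _ _ hbc.symm hs))
    omega
  by_cases hbm : b = m
  · subst hbm
    exact hmB d (hGB _ _ hcd (hGB _ _ hbc hm))
  have hcm : c ≠ m := by rintro rfl; exact Nat.not_even_iff_odd.2 hc hm2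
  have hbs : b ≠ s := by rintro rfl; exact Nat.not_even_iff_odd.2 hs2 hb2
  refine hF.2.2 a b c d ?_ ?_ ?_ ha hc hac
  · rcases (hG _ _).1 hab with h | h | h
    · exact h
    · exact absurd h.2 hbm
    · exact absurd h.2 hbs
  · rcases (hG _ _).1 hbc with h | h | h
    · exact h
    · exact absurd h.1 hbs
    · exact absurd h.1 hbm
  · rcases (hG _ _).1 hcd with h | h | h
    · exact h
    · exact absurd h.1 hcs
    · exact absurd h.1 hcm

lemma SimpleGraph.reachable_sup_edge {α : Type*} {G : SimpleGraph α} {s t x y : α}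
    (h : (G ⊔ SimpleGraph.edge s t).Reachable x y) :
    G.Reachable x y ∨ (G.Reachable x s ∧ G.Reachable t y) ∨
      (G.Reachable x t ∧ G.Reachable s y) := by
  obtain ⟨p⟩ := h
  induction p with
  | nil => exact Or.inl .rfl
  | cons huv _ ih =>
    rename_i u v w
    rw [SimpleGraph.sup_adj, SimpleGraph.edge_adj] at huv
    rcases huv with huv | ⟨⟨rfl, rfl⟩ | ⟨rfl, rfl⟩, -⟩
    · have := huv.reachable
      rcases ih with h | h | h
      · exact Or.inl (this.trans h)
      · exact Or.inr (Or.inl ⟨this.trans h.1, h.2⟩)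
      · exact Or.inr (Or.inr ⟨this.trans h.1, h.2⟩)
    · rcases ih with h | h | h
      · exact Or.inr (Or.inl ⟨.rfl, h⟩)
      · exact Or.inr (Or.inl ⟨.rfl, h.2⟩)
      · exact Or.inl h.2
    · rcases ih with h | h | h
      · exact Or.inr (Or.inr ⟨.rfl, h⟩)
      · exact Or.inl h.2
      · exact Or.inr (Or.inr ⟨.rfl, h.2⟩)

lemma SimpleGraph.card_connectedComponent_sup_edge {α : Type*} [Finite α] {G : SimpleGraph α}
    {s t : α} (h : ¬ G.Reachable s t) :
    Nat.card G.ConnectedComponent =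
      Nat.card (G ⊔ SimpleGraph.edge s t).ConnectedComponent + 1 := by
  have hst : s ≠ t := by rintro rfl; exact h .rfl
  have hadj : (G ⊔ SimpleGraph.edge s t).Adj s t := by
    rw [SimpleGraph.sup_adj, SimpleGraph.edge_adj]
    exact Or.inr ⟨Or.inl ⟨rfl, rfl⟩, hst⟩
  have hle : G ≤ G ⊔ SimpleGraph.edge s t := le_sup_left
  have hbij : Function.Bijective
      (fun c : {c : G.ConnectedComponent // c ≠ G.connectedComponentMk s} =>
        c.1.map (SimpleGraph.Hom.ofLE hle)) := by
    constructor
    · rintro ⟨c, hc⟩ ⟨d, hd⟩ hcd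
      induction c using SimpleGraph.ConnectedComponent.ind with | _ x
      induction d using SimpleGraph.ConnectedComponent.ind with | _ y
      have hxy : (G ⊔ SimpleGraph.edge s t).Reachable x y := SimpleGraph.ConnectedComponent.exact hcd
      refine Subtype.ext (SimpleGraph.ConnectedComponent.sound ?_)
      rcases SimpleGraph.reachable_sup_edge hxy with h' | h' | h'
      · exact h'
      · exact absurd (SimpleGraph.ConnectedComponent.sound h'.1) hc
      · exact absurd (SimpleGraph.ConnectedComponent.sound h'.2.symm) hd
    · intro c
      induction c using SimpleGraph.ConnectedComponent.ind with | _ x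
      by_cases hx : G.Reachable x s
      · refine ⟨⟨G.connectedComponentMk t, fun h' => h (SimpleGraph.ConnectedComponent.exact h').symm⟩,
          SimpleGraph.ConnectedComponent.sound ?_⟩
        exact hadj.symm.reachable.trans (hx.mono hle).symm
      · exact ⟨⟨G.connectedComponentMk x, fun h' => hx (SimpleGraph.ConnectedComponent.exact h')⟩,
          rfl⟩
  rw [← Nat.card_congr (Equiv.ofBijective _ hbij)]
  have : Fintype G.ConnectedComponent := Fintype.ofFinite _
  rw [Nat.card_eq_fintype_card, Nat.card_eq_fintype_card, Fintype.card_subtype_compl,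
    Fintype.card_subtype_eq]
  have : 0 < Fintype.card G.ConnectedComponent :=
    Fintype.card_pos_iff.2 ⟨G.connectedComponentMk s⟩
  omega

/-- The connected components of `F` are the blocks of `P`. -/
def HasBlocks {V : Finset ℕ} (F : SimpleGraph {x // x ∈ V}) (P : Finpartition V) : Prop :=
  ∀ x y : {x // x ∈ V}, F.Reachable x y ↔ ∃ B ∈ P.parts, ↑x ∈ B ∧ ↑y ∈ B

lemma finpartition_le_of_rel {V : Finset ℕ} {P Q : Finpartition V}
    (h : ∀ x y : {x // x ∈ V}, (∃ B ∈ P.parts, ↑x ∈ B ∧ ↑y ∈ B) →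
      ∃ B ∈ Q.parts, ↑x ∈ B ∧ ↑y ∈ B) : P ≤ Q := by
  intro B hB
  obtain ⟨x, hx⟩ := P.nonempty_of_mem_parts hB
  have hxV := P.le hB hx
  obtain ⟨C, hC, hxC⟩ := Q.exists_mem hxV
  refine ⟨C, hC, fun y hy => ?_⟩
  obtain ⟨D, hD, hxD, hyD⟩ := h ⟨x, hxV⟩ ⟨y, P.le hB hy⟩ ⟨B, hB, hx, hy⟩
  rwa [Q.eq_of_mem_parts hC hD hxC hxD]

lemma HasBlocks.unique {V : Finset ℕ} {F : SimpleGraph {x // x ∈ V}} {P Q : Finpartition V}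
    (hP : HasBlocks F P) (hQ : HasBlocks F Q) : P = Q :=
  le_antisymm (finpartition_le_of_rel fun x y => ((hP x y).symm.trans (hQ x y)).1)
    (finpartition_le_of_rel fun x y => ((hP x y).symm.trans (hQ x y)).2)

lemma exists_hasBlocks {V : Finset ℕ} (F : SimpleGraph {x // x ∈ V}) :
    ∃ P : Finpartition V, HasBlocks F P := by
  let S : Setoid ℕ :=
    { r := fun a b => a = b ∨ ∃ (ha : a ∈ V) (hb : b ∈ V), F.Reachable ⟨a, ha⟩ ⟨b, hb⟩
      iseqv :=
        { refl := fun a => Or.inl rfl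
          symm := by
            rintro a b (rfl | ⟨ha, hb, h⟩)
            · exact Or.inl rfl
            · exact Or.inr ⟨hb, ha, h.symm⟩
          trans := by
            rintro a b c (rfl | ⟨ha, hb, h⟩) (rfl | ⟨hb', hc, h'⟩)
            · exact Or.inl rfl
            · exact Or.inr ⟨hb', hc, h'⟩
            · exact Or.inr ⟨ha, hb, h⟩
            · exact Or.inr ⟨ha, hc, h.trans h'⟩ } }
  refine ⟨Finpartition.ofSetSetoid S V, fun x y => ?_⟩
  rw [← Finpartition.mem_part_iff_exists, Finpartition.mem_part_ofSetSetoid_iff_rel]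
  constructor
  · intro h
    exact ⟨y.2, x.2, Or.inr ⟨y.2, x.2, h.symm⟩⟩
  · rintro ⟨-, -, h | ⟨_, _, h⟩⟩
    · rw [Subtype.ext h]
    · exact h.symm

lemma HasBlocks.card_eq {V : Finset ℕ} {F : SimpleGraph {x // x ∈ V}} {P : Finpartition V}
    (h : HasBlocks F P) : Nat.card F.ConnectedComponent = P.parts.card := by
  have hrel : ∀ x y : {x // x ∈ V}, F.Reachable x y ↔ P.part x = P.part y := by
    intro x y
    rw [h x y, ← Finpartition.mem_part_iff_exists, P.mem_part_iff_part_eq_part x.2 y.2]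
  let f : F.ConnectedComponent → {B // B ∈ P.parts} :=
    SimpleGraph.ConnectedComponent.lift (fun v => ⟨P.part v, P.part_mem.2 v.2⟩)
      fun x y p _ => Subtype.ext ((hrel x y).1 ⟨p⟩)
  have hf : Function.Bijective f := by
    constructor
    · intro c d hcd
      induction c using SimpleGraph.ConnectedComponent.ind with | _ x
      induction d using SimpleGraph.ConnectedComponent.ind with | _ y
      exact SimpleGraph.ConnectedComponent.sound ((hrel x y).2 (congrArg Subtype.val hcd))
    · rintro ⟨B, hB⟩
      obtain ⟨x, hx⟩ := P.nonempty_of_mem_parts hB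
      exact ⟨F.connectedComponentMk ⟨x, P.le hB hx⟩, Subtype.ext (P.part_eq_of_mem hB hx)⟩
  rw [Nat.card_congr (Equiv.ofBijective f hf), Nat.card_eq_fintype_card, Fintype.card_coe]

lemma hasBlocks_bot (V : Finset ℕ) : HasBlocks (⊥ : SimpleGraph {x // x ∈ V}) ⊥ := by
  intro x y
  rw [SimpleGraph.reachable_bot]
  constructor
  · rintro rfl
    exact ⟨{↑x}, Finpartition.mem_bot_iff.2 ⟨x, x.2, rfl⟩, by simp, by simp⟩
  · rintro ⟨B, hB, hx, hy⟩
    obtain ⟨a, -, rfl⟩ := Finpartition.mem_bot_iff.1 hB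
    exact Subtype.ext ((Finset.mem_singleton.1 hx).trans (Finset.mem_singleton.1 hy).symm)

lemma HasBlocks.le_iff {V : Finset ℕ} {F : SimpleGraph {x // x ∈ V}} {P Q : Finpartition V}
    (h : HasBlocks F P) :
    P ≤ Q ↔ ∀ x y, F.Adj x y → ∃ B ∈ Q.parts, ↑x ∈ B ∧ ↑y ∈ B := by
  constructor
  · intro hPQ x y hxy
    obtain ⟨B, hB, hx, hy⟩ := (h x y).1 hxy.reachable
    obtain ⟨C, hC, hBC⟩ := hPQ hB
    exact ⟨C, hC, hBC hx, hBC hy⟩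
  · intro hQ
    refine finpartition_le_of_rel fun x y hxy => ?_
    obtain ⟨B, hB, hxB⟩ := Q.exists_mem x.2
    refine ⟨B, hB, hxB, ?_⟩
    let S : Set {x // x ∈ V} := {z | ↑z ∈ B}
    refine mem_of_reachable (B := S) (fun u v huv hu => ?_) ((h x y).2 hxy) hxB
    obtain ⟨C, hC, huC, hvC⟩ := hQ u v huv
    obtain rfl : B = C := Q.eq_of_mem_parts hB hC hu huC
    exact hvC

lemma IsLocalIDForest.isBond {V : Finset ℕ} {F : SimpleGraph {x // x ∈ V}}
    (hF : IsLocalIDForest V F) {P : Finpartition V} (h : HasBlocks F P) : IsBond V P := by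
  intro B hB
  obtain ⟨x, hx⟩ := P.nonempty_of_mem_parts hB
  have key : ∀ a b : {x // x ∈ V}, F.Walk a b → ∀ (ha : ↑a ∈ B) (hb : ↑b ∈ B),
      ((ferrers V).induce (B : Set ℕ)).Reachable ⟨a, ha⟩ ⟨b, hb⟩ := by
    intro a b p
    induction p with
    | nil => exact fun _ _ => .rfl
    | cons hac p ih =>
      rename_i a c b
      intro ha hb
      obtain ⟨C, hC, hcC, hbC⟩ := (h c b).1 ⟨p⟩
      have hc : (c : ℕ) ∈ B := P.eq_of_mem_parts hC hB hbC hb ▸ hcC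
      refine SimpleGraph.Reachable.trans (SimpleGraph.Adj.reachable ?_) (ih hc hb)
      have := hF.2.1 a c hac
      have hne : (a : ℕ) ≠ c := fun h => hac.ne (Subtype.ext h)
      simp only [SimpleGraph.induce_adj, ferrers, SimpleGraph.fromRel_adj]
      have h1 := a.2
      have h2 := c.2
      tauto
  have : Nonempty (B : Set ℕ) := ⟨⟨x, hx⟩⟩
  refine ⟨fun a b => ?_⟩
  obtain ⟨p⟩ := (h ⟨a, P.le hB a.2⟩ ⟨b, P.le hB b.2⟩).2 ⟨B, hB, a.2, b.2⟩
  exact key _ _ p a.2 b.2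

lemma isBond_bot (V : Finset ℕ) : IsBond V ⊥ := by
  refine IsLocalIDForest.isBond (F := ⊥) ⟨SimpleGraph.isAcyclic_bot, ?_, ?_⟩ (hasBlocks_bot V)
  · exact fun _ _ h => h.elim
  · exact fun _ _ _ _ h => h.elim

lemma IsBond.exists_extreme {V : Finset ℕ} {P : Finpartition V} (hP : IsBond V P) (hne : P ≠ ⊥) :
    ∃ B ∈ P.parts, ∃ s ∈ B, ∃ m ∈ B, Odd s ∧ Even m ∧ ∀ u ∈ B, s ≤ u ∧ u ≤ m := by
  have hex : ∃ B ∈ P.parts, B.Nontrivial := by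
    by_contra hcon
    refine hne (le_bot_iff.1 (finpartition_le_of_rel fun x y => ?_))
    rintro ⟨B, hB, hx, hy⟩
    have hxy : (x : ℕ) = y := by
      by_contra hxy
      exact hcon ⟨B, hB, x, hx, y, hy, hxy⟩
    rw [← hxy]
    exact ⟨{↑x}, Finpartition.mem_bot_iff.2 ⟨x, x.2, rfl⟩, by simp, by simp⟩
  obtain ⟨B, hB, hnt⟩ := hex
  have hBn := P.nonempty_of_mem_parts hB
  have : Nontrivial (B : Set ℕ) := by
    obtain ⟨x, hx, y, hy, hxy⟩ := hnt
    exact ⟨⟨x, hx⟩, ⟨y, hy⟩, fun h => hxy (congrArg Subtype.val h)⟩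
  have nbr : ∀ v ∈ B, ∃ w ∈ B, (v < w ∧ Odd v ∧ Even w) ∨ (w < v ∧ Odd w ∧ Even v) := by
    intro v hv
    obtain ⟨w, hw⟩ := (hP B hB).preconnected.exists_adj_of_nontrivial ⟨v, hv⟩
    refine ⟨w, w.2, ?_⟩
    simp only [SimpleGraph.induce_adj, ferrers, SimpleGraph.fromRel_adj] at hw
    tauto
  refine ⟨B, hB, B.min' hBn, B.min'_mem hBn, B.max' hBn, B.max'_mem hBn, ?_, ?_,
    fun u hu => ⟨B.min'_le u hu, B.le_max' u hu⟩⟩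
  · obtain ⟨w, hw, h | h⟩ := nbr _ (B.min'_mem hBn)
    · exact h.2.1
    · exact absurd h.1 (not_lt.2 (B.min'_le w hw))
  · obtain ⟨w, hw, h | h⟩ := nbr _ (B.max'_mem hBn)
    · exact absurd h.1 (not_lt.2 (B.le_max' w hw))
    · exact h.2.2

lemma IsBond.sum_isLocalIDForest {V : Finset ℕ} {P : Finpartition V} (hP : IsBond V P) :
    ∑ F ∈ Finset.univ.filter (fun F : SimpleGraph {x // x ∈ V} => IsLocalIDForest V F ∧
      ∀ x y, F.Adj x y → ∃ B ∈ P.parts, ↑x ∈ B ∧ ↑y ∈ B),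
      (-1 : ℤ) ^ Nat.card F.ConnectedComponent = if ⊥ = P then (-1) ^ V.card else 0 := by
  split_ifs with hbot
  · subst hbot
    have : Finset.univ.filter (fun F : SimpleGraph {x // x ∈ V} => IsLocalIDForest V F ∧
        ∀ x y, F.Adj x y → ∃ B ∈ (⊥ : Finpartition V).parts, ↑x ∈ B ∧ ↑y ∈ B) = {⊥} := by
      ext F
      simp only [Finset.mem_filter, Finset.mem_univ, true_and, Finset.mem_singleton]
      constructor
      · rintro ⟨-, h⟩
        refine le_bot_iff.1 fun x y hxy => ?_
        exact absurd (SimpleGraph.reachable_bot.1 ((hasBlocks_bot V x y).2 (h x y hxy))) hxy.ne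
      · rintro rfl
        exact ⟨⟨SimpleGraph.isAcyclic_bot, fun _ _ h => h.elim, fun _ _ _ _ h => h.elim⟩,
          fun _ _ h => h.elim⟩
    rw [this, Finset.sum_singleton, (hasBlocks_bot V).card_eq, Finpartition.card_bot]
  · obtain ⟨B, hB, s, hs, m, hm, hs2, hm2, hsm⟩ := hP.exists_extreme (Ne.symm hbot)
    let s' : {x // x ∈ V} := ⟨s, P.le hB hs⟩
    let m' : {x // x ∈ V} := ⟨m, P.le hB hm⟩
    have hne : s' ≠ m' := by
      intro h
      have : s = m := congrArg Subtype.val h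
      exact Nat.not_even_iff_odd.2 hs2 (this ▸ hm2)
    have hedge : (SimpleGraph.edge s' m').Adj s' m' := by
      rw [SimpleGraph.edge_adj]
      exact ⟨Or.inl ⟨rfl, rfl⟩, hne⟩
    have hnot : ∀ F : SimpleGraph {x // x ∈ V}, ¬ (F \ SimpleGraph.edge s' m').Adj s' m' :=
      fun F h => h.2 hedge
    have hsup : ∀ F : SimpleGraph {x // x ∈ V}, F.Adj s' m' →
        F \ SimpleGraph.edge s' m' ⊔ SimpleGraph.edge s' m' = F := fun F h =>
      sdiff_sup_cancel ((SimpleGraph.edge_le_iff _).2 (Or.inr h))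
    have hdel : ∀ F : SimpleGraph {x // x ∈ V}, F.IsAcyclic → F.Adj s' m' →
        ¬ (F \ SimpleGraph.edge s' m').Reachable s' m' := by
      intro F hF h hr
      rw [← hsup F h] at hF
      exact ((SimpleGraph.isAcyclic_sup_fromEdgeSet_iff.1 hF).2 hr).elim hne (hnot F)
    have hclosed : ∀ F : SimpleGraph {x // x ∈ V},
        (∀ x y, F.Adj x y → ∃ B ∈ P.parts, ↑x ∈ B ∧ ↑y ∈ B) →
        ∀ u v, F.Adj u v → u ∈ {z : {x // x ∈ V} | ↑z ∈ B} → v ∈ {z : {x // x ∈ V} | ↑z ∈ B} := by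
      intro F hF u v huv hu
      obtain ⟨C, hC, huC, hvC⟩ := hF u v huv
      have : B = C := P.eq_of_mem_parts hB hC hu huC
      exact this ▸ hvC
    have hadd : ∀ F : SimpleGraph {x // x ∈ V}, IsLocalIDForest V F →
        (∀ x y, F.Adj x y → ∃ B ∈ P.parts, ↑x ∈ B ∧ ↑y ∈ B) → ¬ F.Adj s' m' →
        IsLocalIDForest V (F ⊔ SimpleGraph.edge s' m') := fun F hF hFP h =>
      hF.sup_edge (hclosed F hFP) hs hm (fun u hu => (hsm u hu).1) (fun u hu => (hsm u hu).2)
        hs2 hm2 h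
    refine Finset.sum_involution (fun F _ => if F.Adj s' m' then F \ SimpleGraph.edge s' m' else
      F ⊔ SimpleGraph.edge s' m') ?_ ?_ ?_ ?_
    · intro F hF
      obtain ⟨hF, hFP⟩ := (Finset.mem_filter.1 hF).2
      split_ifs with h
      · have := SimpleGraph.card_connectedComponent_sup_edge (hdel F hF.1 h)
        rw [hsup F h] at this
        rw [this, pow_succ]
        ring
      · rw [SimpleGraph.card_connectedComponent_sup_edge (G := F) (s := s') (t := m'), pow_succ]
        · ring
        · exact fun hr => ((SimpleGraph.isAcyclic_sup_fromEdgeSet_iff.1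
            (hadd F hF hFP h).1).2 hr).elim hne h
    · intro F hF _
      split_ifs with h
      · exact fun heq => hnot F (heq.symm ▸ h)
      · exact fun heq => h (heq ▸ (le_sup_right : SimpleGraph.edge s' m' ≤ _) hedge)
    · intro F hF
      obtain ⟨hF, hFP⟩ := (Finset.mem_filter.1 hF).2
      refine Finset.mem_filter.2 ⟨Finset.mem_univ _, ?_⟩
      split_ifs with h
      · exact ⟨hF.anti sdiff_le, fun x y hxy => hFP x y hxy.1⟩
      · refine ⟨hadd F hF hFP h, fun x y hxy => ?_⟩
        rw [SimpleGraph.sup_adj, SimpleGraph.edge_adj] at hxy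
        rcases hxy with hxy | ⟨⟨rfl, rfl⟩ | ⟨rfl, rfl⟩, -⟩
        · exact hFP x y hxy
        · exact ⟨B, hB, hs, hm⟩
        · exact ⟨B, hB, hm, hs⟩
    · intro F hF
      by_cases h : F.Adj s' m'
      · rw [if_pos h, if_neg (hnot F), hsup F h]
      · rw [if_neg h, if_pos ((le_sup_right : SimpleGraph.edge s' m' ≤ _) hedge),
          sup_sdiff_right_self, SimpleGraph.sdiff_edge _ h]

lemma IsBond.sum_hasBlocks {V : Finset ℕ} {P : Finpartition V} (hP : IsBond V P) :
    ∑ c ∈ Finset.univ.filter (fun c => IsBond V c ∧ ⊥ ≤ c ∧ c ≤ P),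
      ∑ F ∈ Finset.univ.filter (fun F : SimpleGraph {x // x ∈ V} =>
        IsLocalIDForest V F ∧ HasBlocks F c), (-1 : ℤ) ^ Nat.card F.ConnectedComponent =
      if ⊥ = P then (-1) ^ V.card else 0 := by
  rw [← hP.sum_isLocalIDForest, ← Finset.sum_biUnion]
  · congr 1
    ext F
    simp only [Finset.mem_biUnion, Finset.mem_filter, Finset.mem_univ, true_and]
    constructor
    · rintro ⟨c, ⟨-, -, hc⟩, hF, hFc⟩
      exact ⟨hF, hFc.le_iff.1 hc⟩
    · rintro ⟨hF, hFP⟩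
      obtain ⟨c, hc⟩ := exists_hasBlocks F
      exact ⟨c, ⟨hF.isBond hc, bot_le, hc.le_iff.2 hFP⟩, hF, hc⟩
  · intro c _ d _ hcd
    refine Finset.disjoint_left.2 fun F hFc hFd => hcd ?_
    exact (Finset.mem_filter.1 hFc).2.2.unique (Finset.mem_filter.1 hFd).2.2

lemma mobius_bot_eq_sum {V : Finset ℕ} (μ : Finpartition V → Finpartition V → ℤ)
    (hμ : ∀ a b : Finpartition V, IsBond V a → IsBond V b → a ≤ b →
      (∑ c ∈ Finset.univ.filter fun c => IsBond V c ∧ a ≤ c ∧ c ≤ b, μ a c) =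
        if a = b then 1 else 0) (P : Finpartition V) (hP : IsBond V P) :
    (-1 : ℤ) ^ V.card * μ ⊥ P =
      ∑ F ∈ Finset.univ.filter (fun F : SimpleGraph {x // x ∈ V} =>
        IsLocalIDForest V F ∧ HasBlocks F P), (-1 : ℤ) ^ Nat.card F.ConnectedComponent := by
  induction P using WellFoundedLT.induction with
  | ind P ih =>
    have h1 := congrArg ((-1 : ℤ) ^ V.card * ·) (hμ ⊥ P (isBond_bot V) hP bot_le)
    have h2 := hP.sum_hasBlocks
    simp only [mul_ite, mul_one, mul_zero, Finset.mul_sum] at h1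
    rw [← h2] at h1
    have hmem : P ∈ Finset.univ.filter (fun c => IsBond V c ∧ ⊥ ≤ c ∧ c ≤ P) := by simp [hP]
    rw [← Finset.add_sum_erase _ _ hmem, ← Finset.add_sum_erase _ _ hmem] at h1
    refine add_right_cancel (h1.trans (congrArg _ (Finset.sum_congr rfl fun c hc => ?_)))
    obtain ⟨hne, hc⟩ := Finset.mem_erase.1 hc
    obtain ⟨hcb, -, hcP⟩ := (Finset.mem_filter.1 hc).2
    exact (ih c (lt_of_le_of_ne hcP hne) hcb).symm

/-- For a partition `π` in the bond lattice of `Γ_V`, `(-1)^{|V|-b(π)} μ(0̂, π)` equals the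
number of ID forests on `V` whose set of tree vertex sets is the set of blocks of `π`.
Here `μ` is any function satisfying the defining recurrence of the Möbius function of the
bond lattice (whose minimum `⊥` is the partition into singletons). -/
theorem stmt2 (V : Finset ℕ) (hV : ∀ v ∈ V, 0 < v) (P : Finpartition V) (hP : IsBond V P)
    (μ : Finpartition V → Finpartition V → ℤ)
    (hμ : ∀ a b : Finpartition V, IsBond V a → IsBond V b → a ≤ b →
      (∑ c ∈ Finset.univ.filter fun c => IsBond V c ∧ a ≤ c ∧ c ≤ b, μ a c) =
        if a = b then 1 else 0) :
    (-1 : ℤ) ^ (V.card - P.parts.card) * μ ⊥ P =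
      Nat.card {F : SimpleGraph {x // x ∈ V} // IsIDForest V F ∧
        ∀ x y : {x // x ∈ V}, F.Reachable x y ↔ ∃ B ∈ P.parts, ↑x ∈ B ∧ ↑y ∈ B} := by
  have hcard : Nat.card {F : SimpleGraph {x // x ∈ V} // IsIDForest V F ∧
        ∀ x y : {x // x ∈ V}, F.Reachable x y ↔ ∃ B ∈ P.parts, ↑x ∈ B ∧ ↑y ∈ B} =
      (Finset.univ.filter (fun F : SimpleGraph {x // x ∈ V} =>
        IsLocalIDForest V F ∧ HasBlocks F P)).card := by
    refine Nat.subtype_card _ fun F => ?_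
    rw [Finset.mem_filter, isIDForest_iff_isLocalIDForest]
    exact and_iff_right (Finset.mem_univ F)
  have hsum : ∑ F ∈ Finset.univ.filter (fun F : SimpleGraph {x // x ∈ V} =>
      IsLocalIDForest V F ∧ HasBlocks F P), (-1 : ℤ) ^ Nat.card F.ConnectedComponent =
      (-1) ^ P.parts.card * (Finset.univ.filter (fun F : SimpleGraph {x // x ∈ V} =>
        IsLocalIDForest V F ∧ HasBlocks F P)).card := by
    rw [Finset.sum_congr rfl fun F hF => by rw [(Finset.mem_filter.1 hF).2.2.card_eq],
      Finset.sum_const, nsmul_eq_mul, mul_comm]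
  rw [hcard]
  have hmain := mobius_bot_eq_sum μ hμ P hP
  rw [hsum] at hmain
  have hsq : (-1 : ℤ) ^ P.parts.card * (-1) ^ P.parts.card = 1 := by
    rw [← mul_pow]
    simp
  have hpow : (-1 : ℤ) ^ V.card = (-1) ^ (V.card - P.parts.card) * (-1) ^ P.parts.card := by
    rw [← pow_add, Nat.sub_add_cancel P.card_parts_le_card]
  rw [hpow] at hmain
  linear_combination ((-1 : ℤ) ^ P.parts.card) * hmain +
    ((Finset.univ.filter (fun F : SimpleGraph {x // x ∈ V} =>
        IsLocalIDForest V F ∧ HasBlocks F P)).card -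
      (-1 : ℤ) ^ (V.card - P.parts.card) * μ ⊥ P) * hsq
end

section
/- For all n ≥ 1, the number of ID trees with vertex set [2n] = {1,2,...,2n} equals the Genocchi number g_n, i.e., equals the number of Dumont permutations on [2n−2]. -/
open Finset

/-- Permutations of `[K]`, extended by the identity to `ℕ`, satisfying the Dumont condition at the
positions in `[L]` and free elsewhere. -/
def partialDumont (L K : ℕ) : Set (Equiv.Perm ℕ) :=
  {σ | (∀ i, i ∉ Icc 1 K → σ i = i) ∧
    ∀ i ∈ Icc 1 L, (Even i → σ i < i) ∧ (Odd i → i ≤ σ i)}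

theorem finite_partialDumont (L K : ℕ) : (partialDumont L K).Finite := by
  have : Finite {f : Equiv.Perm ℕ // ∀ a, ¬ a ∈ Icc 1 K → f a = a} :=
    Finite.of_equiv _ (Equiv.Perm.subtypeEquivSubtypePerm (fun x => x ∈ Icc 1 K))
  have hfin : {f : Equiv.Perm ℕ | ∀ a, ¬ a ∈ Icc 1 K → f a = a}.Finite := this
  exact hfin.subset fun σ h => h.1

theorem card_isDumontPerm (K : ℕ) :
    Nat.card {σ : Equiv.Perm {x // x ∈ Icc 1 K} // IsDumontPerm _ σ}
      = (partialDumont K K).ncard := by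
  rw [← Nat.card_coe_set_eq]
  refine Nat.card_congr
    (((Equiv.Perm.subtypeEquivSubtypePerm (fun x => x ∈ Icc 1 K)).subtypeEquiv
      (q := fun f => f.1 ∈ partialDumont K K) ?_).trans ?_)
  · intro σ
    have key : ∀ i : {x // x ∈ Icc 1 K}, Equiv.Perm.ofSubtype σ (i : ℕ) = σ i :=
      fun i => Equiv.Perm.ofSubtype_apply_coe σ i
    constructor
    · intro h
      refine ⟨fun i hi => Equiv.Perm.ofSubtype_apply_of_not_mem σ hi, fun i hi => ?_⟩
      have := h ⟨i, hi⟩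
      have hk := key ⟨i, hi⟩
      simp only [Equiv.Perm.subtypeEquivSubtypePerm_apply_coe] at *
      rw [hk]
      exact this
    · intro h i
      have := h.2 i i.2
      simp only [Equiv.Perm.subtypeEquivSubtypePerm_apply_coe, key] at this
      exact this
  · exact Equiv.subtypeSubtypeEquivSubtype fun h => h.1

theorem ncard_partialDumont_zero (K : ℕ) : (partialDumont 0 K).ncard = K.factorial := by
  have h := Nat.card_congr (Equiv.Perm.subtypeEquivSubtypePerm (fun x => x ∈ Icc 1 K))
  rw [Nat.card_perm, Nat.card_eq_fintype_card, Fintype.card_coe, Nat.card_Icc] at h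
  rw [← Nat.card_coe_set_eq]
  simp only [add_tsub_cancel_right] at h
  rw [h]
  refine Nat.card_congr (Equiv.subtypeEquivRight fun σ => ?_)
  simp [partialDumont]

/-- If position `L + 1` takes a value greater than `L`, it can be exchanged for a fixed point. -/
theorem ncard_partialDumont_large (L K : ℕ) (hLK : L ≤ K) :
    {σ ∈ partialDumont L (K + 1) | L + 1 ≤ σ (L + 1)}.ncard
      = (K + 1 - L) * (partialDumont L K).ncard := by
  have hcard : (Set.Icc (L + 1) (K + 1)).ncard = K + 1 - L := by
    rw [← Nat.card_coe_set_eq, Nat.card_eq_fintype_card, Fintype.card_ofFinset, Nat.card_Icc]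
    omega
  rw [← hcard, ← Set.ncard_prod]
  symm
  refine Set.ncard_congr
    (fun x _ => Equiv.swap x.1 (K + 1) * x.2 * Equiv.swap (L + 1) (K + 1)) ?_ ?_ ?_
  · rintro ⟨v, τ⟩ ⟨hv, hτ⟩
    simp only [Set.mem_Icc] at hv
    have hfix : τ (K + 1) = K + 1 := hτ.1 _ (by simp)
    refine ⟨⟨fun i hi => ?_, fun i hi => ?_⟩, ?_⟩
    · have h1 : i ≠ L + 1 := by rintro rfl; simp at hi; omega
      have h2 : i ≠ K + 1 := by rintro rfl; simp at hi
      have h3 : τ i = i := hτ.1 i (by simp at hi ⊢; omega)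
      have h4 : i ≠ v := by rintro rfl; simp at hi; omega
      simp [Equiv.swap_apply_of_ne_of_ne h1 h2, h3, Equiv.swap_apply_of_ne_of_ne h4 h2]
    · have hi' := mem_Icc.1 hi
      have h1 : i ≠ L + 1 := by omega
      have h2 : i ≠ K + 1 := by omega
      have := hτ.2 i hi
      simp only [Equiv.Perm.coe_mul, Function.comp_apply, Equiv.swap_apply_of_ne_of_ne h1 h2]
      rw [Equiv.swap_apply_def]
      split_ifs <;> grind
    · simp [hfix]; omega
  · rintro ⟨v, τ⟩ ⟨v', τ'⟩ ⟨hv, hτ⟩ ⟨hv', hτ'⟩ h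
    have hfix : τ (K + 1) = K + 1 := hτ.1 _ (by simp)
    have hfix' : τ' (K + 1) = K + 1 := hτ'.1 _ (by simp)
    have hvv : v = v' := by
      have := congrArg (fun σ : Equiv.Perm ℕ => σ (L + 1)) h
      simpa [hfix, hfix'] using this
    subst hvv
    simpa using h
  · rintro σ ⟨hσ, hL⟩
    have hb : σ (L + 1) ≤ K + 1 := by
      by_contra hc
      have h1 := hσ.1 (σ (L + 1)) (by simp; omega)
      have := σ.injective h1
      omega
    refine ⟨(σ (L + 1), Equiv.swap (σ (L + 1)) (K + 1) * σ * Equiv.swap (L + 1) (K + 1)),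
      ⟨⟨hL, hb⟩, fun i hi => ?_, fun i hi => ?_⟩, ?_⟩
    · by_cases h2 : i = K + 1
      · subst h2; simp
      have hi' : i ∉ Icc 1 (K + 1) := by simp at hi ⊢; omega
      have h1 : i ≠ L + 1 := by rintro rfl; simp at hi; omega
      have h4 : i ≠ σ (L + 1) := by intro h; simp at hi; omega
      simp [Equiv.swap_apply_of_ne_of_ne h1 h2, hσ.1 i hi', Equiv.swap_apply_of_ne_of_ne h4 h2]
    · have hi' := mem_Icc.1 hi
      have h1 : i ≠ L + 1 := by omega
      have h2 : i ≠ K + 1 := by omega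
      have := hσ.2 i hi
      simp only [Equiv.Perm.coe_mul, Function.comp_apply, Equiv.swap_apply_of_ne_of_ne h1 h2]
      rw [Equiv.swap_apply_def]
      split_ifs <;> grind
    · simp only [mul_assoc, Equiv.swap_mul_self, mul_one]
      rw [← mul_assoc, Equiv.swap_mul_self, one_mul]

theorem ncard_partialDumont_odd (L K : ℕ) (hLK : L ≤ K) (hL : Even L) :
    (partialDumont (L + 1) (K + 1)).ncard = (K + 1 - L) * (partialDumont L K).ncard := by
  rw [← ncard_partialDumont_large L K hLK]
  congr 1
  ext σ
  have hodd : Odd (L + 1) := hL.add_one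
  constructor
  · intro h
    exact ⟨⟨h.1, fun i hi => h.2 i (by simp at hi ⊢; omega)⟩, (h.2 (L + 1) (by simp)).2 hodd⟩
  · rintro ⟨h, h'⟩
    refine ⟨h.1, fun i hi => ?_⟩
    by_cases hi' : i = L + 1
    · subst hi'
      exact ⟨fun he => absurd hodd (Nat.not_odd_iff_even.2 he), fun _ => h'⟩
    · exact h.2 i (by simp at hi ⊢; omega)

theorem ncard_partialDumont_even (L K : ℕ) (hLK : L ≤ K) (hL : Odd L) :
    (partialDumont (L + 1) (K + 1)).ncard + (K + 1 - L) * (partialDumont L K).ncard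
      = (partialDumont L (K + 1)).ncard := by
  rw [← ncard_partialDumont_large L K hLK, ← Set.ncard_union_eq ?_
      (finite_partialDumont _ _) ((finite_partialDumont _ _).subset fun σ h => h.1)]
  · congr 1
    ext σ
    have heven : Even (L + 1) := hL.add_one
    constructor
    · rintro (h | h)
      · exact ⟨h.1, fun i hi => h.2 i (by simp at hi ⊢; omega)⟩
      · exact h.1
    · intro h
      by_cases h' : L + 1 ≤ σ (L + 1)
      · exact Or.inr ⟨h, h'⟩
      · refine Or.inl ⟨h.1, fun i hi => ?_⟩
        by_cases hi' : i = L + 1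
        · subst hi'
          exact ⟨fun _ => by omega, fun ho => absurd ho (Nat.not_odd_iff_even.2 heven)⟩
        · exact h.2 i (by simp at hi ⊢; omega)
  · rw [Set.disjoint_left]
    rintro σ h ⟨-, h'⟩
    have := (h.2 (L + 1) (by simp)).1 hL.add_one
    omega

open Polynomial in
/-- The Gandhi operator `p(x) ↦ x ((x + 1) p(x + 1) - x p(x))`. -/
noncomputable def gandhi : ℤ[X] →ₗ[ℤ] ℤ[X] :=
  LinearMap.mulLeft ℤ X ∘ₗ (taylor 1 - LinearMap.id) ∘ₗ LinearMap.mulLeft ℤ X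

open Polynomial in
theorem gandhi_apply (p : ℤ[X]) : gandhi p = X * (taylor 1 (X * p) - X * p) := by
  simp [gandhi]

open Polynomial in
theorem eval_gandhi (p : ℤ[X]) (x : ℤ) :
    (gandhi p).eval x = x * ((x + 1) * p.eval (x + 1) - x * p.eval x) := by
  simp [gandhi_apply, taylor_eval]

open Polynomial in
theorem ncard_partialDumont_eq_eval (j y : ℕ) :
    ((partialDumont (2 * j) (2 * j + y)).ncard : ℤ)
      = y.factorial * ((gandhi ^ j) 1).eval ((y : ℤ) + 1) := by
  induction j generalizing y with
  | zero => simp [ncard_partialDumont_zero]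
  | succ j ih =>
    have h1 := ncard_partialDumont_odd (2 * j) (2 * j + y) (by omega) (by simp)
    have h2 := ncard_partialDumont_odd (2 * j) (2 * j + y + 1) (by omega) (by simp)
    have h3 := ncard_partialDumont_even (2 * j + 1) (2 * j + y + 1) (by omega) (by simp)
    have ih1 := ih y
    have ih2 := ih (y + 1)
    rw [show 2 * j + y + 1 - 2 * j = y + 1 by omega] at h1
    rw [show 2 * j + y + 1 + 1 - 2 * j = y + 2 by omega] at h2
    rw [show 2 * j + y + 1 + 1 - (2 * j + 1) = y + 1 by omega, h1, h2] at h3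
    rw [show 2 * (j + 1) = 2 * j + 1 + 1 by ring, show 2 * j + 1 + 1 + y = 2 * j + y + 1 + 1 by ring,
      pow_succ', Module.End.mul_apply, eval_gandhi]
    have h3' := congrArg (Nat.cast : ℕ → ℤ) h3
    push_cast [Nat.factorial_succ] at h3' ih2
    rw [ih1, show 2 * j + y + 1 = 2 * j + (y + 1) by ring, ih2] at h3'
    rw [show 2 * j + y + 1 = 2 * j + (y + 1) by ring]
    linear_combination h3'

open Polynomial in
theorem genocchi_eq_coeff (n : ℕ) (hn : 1 ≤ n) :
    (genocchi n : ℤ) = ((gandhi ^ n) 1).coeff 1 := by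
  obtain ⟨m, rfl⟩ : ∃ m, n = m + 1 := ⟨n - 1, by omega⟩
  rw [pow_succ', Module.End.mul_apply, gandhi_apply, coeff_X_mul, coeff_zero_eq_eval_zero,
    genocchi, card_isDumontPerm, show 2 * (m + 1) - 2 = 2 * m by omega]
  have := ncard_partialDumont_eq_eval m 0
  simp [taylor_eval] at this ⊢
  exact this

/-- Parent functions of ID trees with vertex set `V` and root `r`, extended by the identity. -/
def idParent (V : Finset ℕ) (r : ℕ) : Set (ℕ → ℕ) :=
  {f | (∀ v, v ∉ V ∨ v = r → f v = v) ∧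
    ∀ v ∈ V, v ≠ r → f v ∈ V ∧
      (Odd v → Even (f v) ∧ v < f v ∧ (f v = r ∨ f (f v) < v)) ∧
      (Even v → Odd (f v) ∧ f v < v ∧ v < f (f v))}

theorem finite_idParent (V : Finset ℕ) (r : ℕ) : Finite (idParent V r) := by
  have hmem : ∀ f ∈ idParent V r, ∀ v ∈ V, f v ∈ V := by
    intro f hf v hv
    by_cases h : v = r
    · rw [hf.1 v (Or.inr h)]; exact hv
    · exact (hf.2 v hv h).1
  refine Finite.of_injective
    (fun (f : idParent V r) (v : V) => (⟨f.1 v, hmem f.1 f.2 v v.2⟩ : V)) ?_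
  intro f g h
  ext v
  by_cases hv : v ∈ V
  · exact congrArg Subtype.val (congrFun h ⟨v, hv⟩)
  · rw [f.2.1 v (Or.inl hv), g.2.1 v (Or.inl hv)]

/-- Make `p` a child of `max S`, and the other elements of `S` children of `p`. -/
def graft (p : ℕ) (S : Finset ℕ) (g : ℕ → ℕ) (v : ℕ) : ℕ :=
  if v = p then S.sup id else if v ∈ S ∧ v ≠ S.sup id then p else g v

theorem Finset.sup_id_mem {S : Finset ℕ} (hS : S.Nonempty) : S.sup id ∈ S := by
  obtain ⟨e, he, h⟩ := S.exists_mem_eq_sup hS id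
  rw [h]; exact he

theorem graft_mem_idParent {V H S : Finset ℕ} {p r : ℕ} {g : ℕ → ℕ} (hp : Odd p)
    (hV : ∀ v ∈ V, v < p) (hH : ∀ v ∈ H, p < v ∧ Even v ∧ v ≤ r) (hr : r ∈ H)
    (hSH : S ⊆ H) (hS : S.Nonempty) (hg : g ∈ idParent (V ∪ (H \ S.erase (S.sup id))) r) :
    graft p S g ∈ idParent (insert p (V ∪ H)) r := by
  obtain ⟨hg1, hg2⟩ := hg
  have he := Finset.sup_id_mem hS
  have hle : ∀ s ∈ S, s ≤ S.sup id := fun s hs => Finset.le_sup (f := id) hs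
  set e := S.sup id with he_def
  have hgraft : graft p S g = fun v => if v = p then e else if v ∈ S ∧ v ≠ e then p else g v := by
    funext v; simp [graft, ← he_def]
  rw [hgraft]
  have hpar : Even p → False := fun h => (Nat.not_even_iff_odd.2 hp) h
  have hrS : r ∈ S → r = e := fun h => le_antisymm (hle r h) (hH e (hSH he)).2.2
  simp only [mem_union, mem_sdiff, mem_erase] at hg1 hg2
  have heH := hSH he
  have hnp : ∀ v, v ∉ S ∨ v = e → v ∈ V ∨ v ∈ H → (g v ∈ V ∨ g v ∈ H) ∧ (g v ∉ S ∨ g v = e) := by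
    intro v hv hvV
    by_cases hvr : v = r
    · rw [hg1 v (Or.inr hvr)]; exact ⟨hvV, hv⟩
    · have := (hg2 v (by tauto) hvr).1
      refine ⟨by tauto, ?_⟩
      rcases this with h | h
      · left; intro h'; have := hV _ h; have := hH _ (hSH h'); omega
      · tauto
  have key : ∀ v, (v ∉ S ∨ v = e) → v ∈ V ∨ v ∈ H →
      (if g v = p then e else if g v ∈ S ∧ g v ≠ e then p else g (g v)) = g (g v) := by
    intro v hv hvV
    obtain ⟨h1, h2⟩ := hnp v hv hvV
    rw [if_neg, if_neg]
    · tauto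
    · intro h
      rw [h] at h1
      rcases h1 with h1 | h1
      · exact absurd (hV _ h1) (lt_irrefl _)
      · exact absurd (hH _ h1).1 (lt_irrefl _)
  have hep : e ≠ p := (hH e heH).1.ne'
  refine ⟨fun v hv => ?_, fun v hv hvr => ?_⟩
  · simp only [mem_insert, mem_union] at hv
    have hvp : v ≠ p := by
      rintro rfl
      rcases hv with hv | hv
      · tauto
      · have := (hH r hr).1; omega
    have hvS : ¬ (v ∈ S ∧ v ≠ e) := by
      rintro ⟨h1, h2⟩
      rcases hv with hv | rfl
      · exact hv (Or.inr (Or.inr (hSH h1)))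
      · exact h2 (hrS h1)
    simp only [if_neg hvp, if_neg hvS]
    apply hg1
    tauto
  · simp only [mem_insert, mem_union] at hv ⊢
    by_cases hvp : v = p
    · subst hvp
      simp only [if_true, if_neg hep, ne_eq, not_true_eq_false, and_false, if_false]
      refine ⟨by tauto, fun _ => ⟨(hH e heH).2.1, (hH e heH).1, ?_⟩, fun h => (hpar h).elim⟩
      by_cases her : e = r
      · exact Or.inl her
      · right
        have h := hg2 e (by tauto) her
        have h1 := h.2.2 (hH e heH).2.1
        rcases h.1 with h2 | h2
        · exact hV _ h2
        · exact absurd (hH _ h2.1).2.1 (Nat.not_even_iff_odd.2 h1.1)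
    · by_cases hvS : v ∈ S ∧ v ≠ e
      · simp only [if_neg hvp, if_pos hvS, if_true]
        have hvH := hH v (hSH hvS.1)
        refine ⟨by tauto, fun h => absurd hvH.2.1 (Nat.not_even_iff_odd.2 h),
          fun _ => ⟨hp, hvH.1, lt_of_le_of_ne (hle v hvS.1) hvS.2⟩⟩
      · have hvS' : v ∉ S ∨ v = e := by tauto
        have hvV : v ∈ V ∨ v ∈ H := by tauto
        simp only [if_neg hvp, if_neg hvS, key v hvS' hvV]
        have h := hg2 v (hvV.imp_right fun hvH => ⟨hvH, fun h => hvS h.symm⟩) hvr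
        exact ⟨Or.inr (h.1.imp_right And.left), h.2⟩

theorem exists_graft_eq {V H : Finset ℕ} {p r : ℕ} {f : ℕ → ℕ} (hp : Odd p)
    (hV : ∀ v ∈ V, v < p) (hH : ∀ v ∈ H, p < v ∧ Even v ∧ v ≤ r) (hr : r ∈ H)
    (hf : f ∈ idParent (insert p (V ∪ H)) r) :
    ∃ S ⊆ H, S.Nonempty ∧ ∃ g ∈ idParent (V ∪ (H \ S.erase (S.sup id))) r, graft p S g = f := by
  obtain ⟨hf1, hf2⟩ := hf
  simp only [mem_insert, mem_union] at hf1 hf2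
  have hpr : p ≠ r := (hH r hr).1.ne
  have hpV : p ∉ V := fun h => lt_irrefl _ (hV p h)
  have hpH : p ∉ H := fun h => lt_irrefl _ (hH p h).1
  have hfp := hf2 p (Or.inl rfl) hpr
  have hfpo := hfp.2.1 hp
  have hfpH : f p ∈ H := by
    rcases hfp.1 with h | h | h
    · omega
    · have := hV _ h; omega
    · exact h
  have hchild : ∀ v, v ∉ H → v ≠ p → f v ≠ p := by
    intro v hv hvp h
    by_cases hvV : v ∈ V
    · have h1 := hf2 v (by tauto) (by rintro rfl; exact hv hr)
      rcases Nat.even_or_odd v with h2 | h2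
      · have := (h1.2.2 h2).2.1; have := hV v hvV; omega
      · have := (h1.2.1 h2).1
        rw [h] at this
        exact absurd this (Nat.not_even_iff_odd.2 hp)
    · exact hvp (by rw [← hf1 v (by tauto)]; exact h)
  have hffp : f (f p) ≠ p := by
    intro h
    rcases hfpo.2.2 with h' | h'
    · rw [h', hf1 r (Or.inr rfl)] at h; exact hpr h.symm
    · omega
  set S := insert (f p) (H.filter fun v => f v = p) with hSdef
  have hmemS : ∀ v, v ∈ S ↔ v = f p ∨ (v ∈ H ∧ f v = p) := by simp [hSdef]
  have hSH : S ⊆ H := by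
    intro v hv
    rcases (hmemS v).1 hv with rfl | h
    · exact hfpH
    · exact h.1
  have hsup : S.sup id = f p := by
    apply le_antisymm
    · refine Finset.sup_le fun v hv => ?_
      rcases (hmemS v).1 hv with rfl | ⟨h1, h2⟩
      · exact le_rfl
      · have hvr : v ≠ r := by rintro rfl; rw [hf1 v (Or.inr rfl)] at h2; omega
        have := ((hf2 v (by tauto) hvr).2.2 (hH v h1).2.1).2.2
        rw [h2] at this
        exact this.le
    · exact Finset.le_sup (f := id) ((hmemS _).2 (Or.inl rfl))
  have hmemE : ∀ v, v ∈ S.erase (S.sup id) ↔ v ∈ H ∧ f v = p := by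
    intro v
    rw [mem_erase, hmemS, hsup]
    constructor
    · tauto
    · rintro ⟨h1, h2⟩
      exact ⟨by rintro rfl; exact hffp h2, Or.inr ⟨h1, h2⟩⟩
  let g : ℕ → ℕ := fun v => if v = p ∨ (v ∈ H ∧ f v = p) then v else f v
  refine ⟨S, hSH, ⟨f p, (hmemS _).2 (Or.inl rfl)⟩, g, ⟨fun v hv => ?_, fun v hv hvr => ?_⟩, ?_⟩
  · simp only [mem_union, mem_sdiff, hmemE] at hv
    by_cases h : v = p ∨ (v ∈ H ∧ f v = p)
    · simp [g, if_pos h]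
    · simp only [g, if_neg h]
      apply hf1
      rcases hv with hv | hv
      · left
        rintro (h' | h' | h')
        · exact h (Or.inl h')
        · exact hv (Or.inl h')
        · exact hv (Or.inr ⟨h', fun h'' => h (Or.inr h'')⟩)
      · exact Or.inr hv
  · simp only [mem_union, mem_sdiff, hmemE] at hv ⊢
    have hvp : v ≠ p := by
      rintro rfl
      exact hv.elim hpV fun h => hpH h.1
    have hv' : ¬ (v = p ∨ (v ∈ H ∧ f v = p)) := by
      rintro (h | ⟨h1, h2⟩)
      · exact hvp h
      · rcases hv with hv | hv
        · exact absurd (hV v hv) (hH v h1).1.not_gt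
        · exact hv.2 ⟨h1, h2⟩
    have hfv : f v ≠ p := by
      by_cases hvH : v ∈ H
      · exact fun h => hv' (Or.inr ⟨hvH, h⟩)
      · exact hchild v hvH hvp
    have h := hf2 v (Or.inr (hv.imp_right And.left)) hvr
    have hgv : g v = f v := if_neg hv'
    have hgr : f v ∈ H → f (f v) ≠ p := by
      intro h1 h2
      have hodd : Odd v := by
        by_contra h3
        exact absurd (hH _ h1).2.1
          (Nat.not_even_iff_odd.2 (h.2.2 (Nat.not_odd_iff_even.1 h3)).1)
      rcases (h.2.1 hodd).2.2 with h3 | h3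
      · rw [h3, hf1 r (Or.inr rfl)] at h2
        exact hpr h2.symm
      · have hvV : v ∈ V := by
          rcases hv with hv | hv
          · exact hv
          · exact absurd (hH _ hv.1).2.1 (Nat.not_even_iff_odd.2 hodd)
        have := hV v hvV
        omega
    have hggv : g (f v) = f (f v) :=
      if_neg fun h' => h'.elim hfv fun h'' => hgr h''.1 h''.2
    rw [hgv, hggv]
    refine ⟨?_, h.2⟩
    rcases h.1 with h1 | h1 | h1
    · exact absurd h1 hfv
    · exact Or.inl h1
    · exact Or.inr ⟨h1, fun h' => hgr h1 h'.2⟩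
  · funext v
    simp only [graft]
    by_cases hvp : v = p
    · rw [if_pos hvp, hvp, hsup]
    · have : (v ∈ S ∧ v ≠ S.sup id) ↔ v ∈ H ∧ f v = p := by rw [← hmemE, mem_erase, and_comm]
      simp only [hvp, if_false, this, g, false_or]
      by_cases h : v ∈ H ∧ f v = p
      · rw [if_pos h, h.2]
      · rw [if_neg h, if_neg h]

theorem graft_injective {V H S S' : Finset ℕ} {p r : ℕ} {g g' : ℕ → ℕ}
    (hV : ∀ v ∈ V, v < p) (hH : ∀ v ∈ H, p < v)
    (hSH : S ⊆ H) (hS : S.Nonempty) (hg : g ∈ idParent (V ∪ (H \ S.erase (S.sup id))) r)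
    (hSH' : S' ⊆ H) (hS' : S'.Nonempty)
    (hg' : g' ∈ idParent (V ∪ (H \ S'.erase (S'.sup id))) r)
    (h : graft p S g = graft p S' g') : S = S' ∧ g = g' := by
  have hsup : S.sup id = S'.sup id := by simpa [graft] using congrFun h p
  have aux : ∀ {S : Finset ℕ} {g : ℕ → ℕ}, S ⊆ H → S.Nonempty →
      g ∈ idParent (V ∪ (H \ S.erase (S.sup id))) r →
      (∀ v, v ∈ S ↔ v = S.sup id ∨ (v ≠ p ∧ graft p S g v = p)) ∧
      (∀ v, g v = if v = p ∨ (v ∈ S ∧ v ≠ S.sup id) then v else graft p S g v) := by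
    intro S g hSH hS hg
    have hpS : p ∉ S := fun h => lt_irrefl _ (hH p (hSH h))
    have hpU : p ∉ V ∪ (H \ S.erase (S.sup id)) := by
      simp only [mem_union, mem_sdiff]
      rintro (h | h)
      · exact lt_irrefl _ (hV p h)
      · exact lt_irrefl _ (hH p h.1)
    have hgp : ∀ v, v ≠ p → g v ≠ p := by
      intro v hv h
      by_cases hvU : v ∉ V ∪ (H \ S.erase (S.sup id)) ∨ v = r
      · rw [hg.1 v hvU] at h; exact hv h
      · push Not at hvU
        exact hpU (h ▸ (hg.2 v hvU.1 hvU.2).1)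
    have he := Finset.sup_id_mem hS
    refine ⟨fun v => ⟨fun hv => ?_, ?_⟩, fun v => ?_⟩
    · by_cases hve : v = S.sup id
      · exact Or.inl hve
      · have hvp : v ≠ p := by rintro rfl; exact hpS hv
        exact Or.inr ⟨hvp, by rw [graft, if_neg hvp, if_pos ⟨hv, hve⟩]⟩
    · rintro (hv | ⟨hvp, hv⟩)
      · rw [hv]; exact he
      · by_contra hvS
        rw [graft, if_neg hvp, if_neg (by tauto)] at hv
        exact hgp v hvp hv
    · by_cases hvp : v = p
      · rw [if_pos (Or.inl hvp), hvp]
        exact hg.1 p (Or.inl hpU)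
      · by_cases hvS : v ∈ S ∧ v ≠ S.sup id
        · rw [if_pos (Or.inr hvS)]
          apply hg.1
          left
          simp only [mem_union, mem_sdiff, mem_erase]
          rintro (h | h)
          · exact absurd (hV v h) (hH v (hSH hvS.1)).not_gt
          · tauto
        · rw [if_neg (by tauto), graft, if_neg hvp, if_neg hvS]
  obtain ⟨h1, h2⟩ := aux hSH hS hg
  obtain ⟨h1', h2'⟩ := aux hSH' hS' hg'
  have hSS : S = S' := by ext v; rw [h1, h1', h, hsup]
  subst hSS
  exact ⟨rfl, by funext v; rw [h2, h2', h]⟩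

theorem card_idParent_insert {V H : Finset ℕ} {p r : ℕ} (hp : Odd p)
    (hV : ∀ v ∈ V, v < p) (hH : ∀ v ∈ H, p < v ∧ Even v ∧ v ≤ r) (hr : r ∈ H) :
    Nat.card (idParent (insert p (V ∪ H)) r)
      = ∑ S ∈ H.powerset.erase ∅, Nat.card (idParent (V ∪ (H \ S.erase (S.sup id))) r) := by
  have : ∀ S : Finset ℕ, Finite (idParent (V ∪ (H \ S.erase (S.sup id))) r) := fun S => finite_idParent _ _
  have hmem : ∀ S : {S // S ∈ H.powerset.erase ∅}, S.1 ⊆ H ∧ S.1.Nonempty := by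
    rintro ⟨S, hS⟩
    rw [mem_erase, mem_powerset] at hS
    exact ⟨hS.2, nonempty_iff_ne_empty.2 hS.1⟩
  rw [← Finset.sum_coe_sort, ← Nat.card_sigma]
  symm
  refine Nat.card_eq_of_bijective (fun x : (S : {S // S ∈ H.powerset.erase ∅}) ×
    idParent (V ∪ (H \ S.1.erase (S.1.sup id))) r => (⟨graft p x.1.1 x.2.1,
      graft_mem_idParent hp hV hH hr (hmem x.1).1 (hmem x.1).2 x.2.2⟩ :
        idParent (insert p (V ∪ H)) r)) ⟨?_, ?_⟩
  · rintro ⟨⟨S, hS⟩, ⟨g, hg⟩⟩ ⟨⟨S', hS'⟩, ⟨g', hg'⟩⟩ h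
    obtain ⟨rfl, rfl⟩ := graft_injective hV (fun v hv => (hH v hv).1) (hmem ⟨S, hS⟩).1
      (hmem ⟨S, hS⟩).2 hg (hmem ⟨S', hS'⟩).1 (hmem ⟨S', hS'⟩).2 hg' (congrArg Subtype.val h)
    rfl
  · rintro ⟨f, hf⟩
    obtain ⟨S, hSH, hS, g, hg, h⟩ := exists_graft_eq hp hV hH hr hf
    exact ⟨⟨⟨S, by rw [mem_erase, mem_powerset]; exact ⟨hS.ne_empty, hSH⟩⟩, ⟨g, hg⟩⟩,
      Subtype.ext h⟩

open Polynomial in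
theorem gandhi_X_pow (k : ℕ) :
    gandhi (X ^ k) = ∑ j ∈ range (k + 1), ((k + 1).choose j : ℤ) • X ^ (j + 1) := by
  rw [gandhi_apply, ← pow_succ', taylor_X_pow, map_one, add_pow, Finset.sum_range_succ]
  simp only [one_pow, mul_one, Nat.choose_self, Nat.cast_one, add_sub_cancel_right]
  rw [Finset.mul_sum]
  refine Finset.sum_congr rfl fun j _ => ?_
  rw [zsmul_eq_mul]
  push_cast
  ring

open Polynomial in
theorem card_idParent_eq_coeff (i r : ℕ) (K : Finset ℕ)
    (hK : ∀ v ∈ K, 2 * i < v ∧ Even v ∧ v ≤ r) (hr : r ∈ Icc 1 (2 * i) ∪ K)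
    (hri : Even r ∧ 2 * i ≤ r) :
    (Nat.card (idParent (Icc 1 (2 * i) ∪ K) r) : ℤ) = ((gandhi ^ i) (X ^ #K)).coeff 1 := by
  induction i generalizing K with
  | zero =>
    simp only [mul_zero, Icc_eq_empty_of_lt zero_lt_one, empty_union] at *
    rw [pow_zero, Module.End.one_apply, coeff_X_pow]
    split_ifs with h
    · obtain ⟨a, rfl⟩ := card_eq_one.1 h.symm
      rw [mem_singleton] at hr
      subst hr
      rw [Nat.cast_eq_one, Nat.card_eq_one_iff_unique]
      refine ⟨⟨fun f g => ?_⟩, ⟨⟨id, fun _ _ => rfl, fun v hv hvr => ?_⟩⟩⟩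
      · ext v
        rw [f.2.1 v, g.2.1 v] <;> simpa using (em (v = r)).symm
      · exact absurd (mem_singleton.1 hv) hvr
    · rw [Nat.cast_eq_zero]
      have hlt : 1 < #K := lt_of_le_of_ne (card_pos.2 ⟨r, hr⟩) h
      obtain ⟨q, hq, hqr⟩ := exists_mem_ne hlt r
      have : IsEmpty (idParent K r) := ⟨fun f => by
        have h1 := f.2.2 q hq hqr
        exact absurd (hK _ h1.1).2.1 (Nat.not_even_iff_odd.2 (h1.2.2 (hK q hq).2.1).1)⟩
      exact Nat.card_of_isEmpty
  | succ i ih =>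
    set H := insert (2 * i + 2) K with hHdef
    have hnot : 2 * i + 2 ∉ K := fun h => by have := (hK _ h).1; omega
    have hHcard : #H = #K + 1 := card_insert_of_notMem hnot
    have hH : ∀ v ∈ H, 2 * i + 1 < v ∧ Even v ∧ v ≤ r := by
      intro v hv
      rcases mem_insert.1 hv with rfl | hv
      · exact ⟨by omega, by simp [parity_simps], by omega⟩
      · have := hK v hv
        exact ⟨by omega, this.2⟩
    have hrH : r ∈ H := by
      rw [mem_union, mem_Icc] at hr
      rw [mem_insert]
      rcases hr with hr | hr
      · left; omega
      · exact Or.inr hr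
    have hset : Icc 1 (2 * (i + 1)) ∪ K = insert (2 * i + 1) (Icc 1 (2 * i) ∪ H) := by
      ext v
      simp only [mem_union, mem_Icc, mem_insert, hHdef]
      by_cases hv : v ∈ K
      · simp [hv]
      · simp only [hv, or_false]; omega
    have hodd : Odd (2 * i + 1) := by simp
    rw [hset, card_idParent_insert hodd (fun v hv => by rw [mem_Icc] at hv; omega) hH hrH,
      Nat.cast_sum]
    have hterm : ∀ S ∈ H.powerset.erase ∅,
        (Nat.card (idParent (Icc 1 (2 * i) ∪ (H \ S.erase (S.sup id))) r) : ℤ)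
          = ((gandhi ^ i) (X ^ (#K + 2 - #S))).coeff 1 := by
      intro S hS
      rw [mem_erase, mem_powerset] at hS
      have hne : S.Nonempty := nonempty_iff_ne_empty.2 hS.1
      have he := Finset.sup_id_mem hne
      have hre : r ∉ S.erase (S.sup id) := by
        intro h
        rw [mem_erase] at h
        exact h.1 (le_antisymm (Finset.le_sup (f := id) h.2) (hH _ (hS.2 he)).2.2)
      rw [ih]
      · rw [card_sdiff_of_subset ((erase_subset _ _).trans hS.2), card_erase_of_mem he, hHcard]
        have := hne.card_pos
        congr 3
        omega
      · intro v hv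
        have := hH v (mem_sdiff.1 hv).1
        exact ⟨by omega, this.2⟩
      · exact mem_union_right _ (mem_sdiff.2 ⟨hrH, hre⟩)
      · exact ⟨hri.1, by omega⟩
    rw [Finset.sum_congr rfl hterm]
    have hsum := Finset.sum_powerset_apply_card
      (fun s => if s = 0 then (0 : ℤ) else ((gandhi ^ i) (X ^ (#K + 2 - s))).coeff 1) (x := H)
    rw [← Finset.add_sum_erase _ _ (empty_mem_powerset H), card_empty, if_pos rfl, zero_add] at hsum
    rw [Finset.sum_congr rfl fun S hS => (if_neg (card_ne_zero.2
      (nonempty_iff_ne_empty.2 (mem_erase.1 hS).1))).symm, hsum, hHcard, pow_succ,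
      Module.End.mul_apply, gandhi_X_pow, map_sum, finsetSum_coeff, Finset.sum_range_succ',
      ← Finset.sum_range_reflect]
    simp only [if_true, smul_zero, add_zero]
    refine Finset.sum_congr rfl fun j hj => ?_
    rw [mem_range] at hj
    rw [if_neg (by omega), map_zsmul, coeff_smul, nsmul_eq_mul, smul_eq_mul,
      show #K + 1 - 1 - j + 1 = #K + 1 - j by omega, Nat.choose_symm (by omega),
      show #K + 2 - (#K + 1 - j) = j + 1 by omega]

/-- The graph joining every `v` to its parent `f v`. -/
def parentGraph {α : Type*} (f : α → α) : SimpleGraph α :=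
  SimpleGraph.fromRel fun u v => f u = v

theorem parentGraph_adj {α : Type*} (f : α → α) (u v : α) :
    (parentGraph f).Adj u v ↔ u ≠ v ∧ (f u = v ∨ f v = u) :=
  SimpleGraph.fromRel_adj _ _ _

section Rank

variable {α : Type*} {f : α → α} {r : α} {ρ : α → ℕ}

theorem exists_walk_parentGraph (hρ : ∀ v, v ≠ r → ρ (f v) < ρ v) (v : α) :
    ∃ p : (parentGraph f).Walk v r, ∀ w ∈ p.support, ∃ k, f^[k] v = w := by
  induction hk : ρ v using Nat.strong_induction_on generalizing v with
  | _ k ih =>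
    by_cases hv : v = r
    · subst hv
      exact ⟨.nil, fun w hw => ⟨0, (SimpleGraph.Walk.mem_support_nil_iff.1 hw).symm⟩⟩
    · have hlt := hρ v hv
      obtain ⟨p, hp⟩ := ih _ (hk ▸ hlt) (f v) rfl
      have hadj : (parentGraph f).Adj v (f v) := by
        rw [parentGraph_adj]
        exact ⟨fun h => by rw [← h] at hlt; exact lt_irrefl _ hlt, Or.inl rfl⟩
      refine ⟨.cons hadj p, fun w hw => ?_⟩
      rw [SimpleGraph.Walk.support_cons, List.mem_cons] at hw
      rcases hw with rfl | hw
      · exact ⟨0, rfl⟩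
      · obtain ⟨k, hk⟩ := hp w hw
        exact ⟨k + 1, hk⟩

theorem isTree_parentGraph [Finite α] (hρ : ∀ v, v ≠ r → ρ (f v) < ρ v) (hr : f r = r) :
    (parentGraph f).IsTree := by
  have hconn : (parentGraph f).Connected := by
    rw [SimpleGraph.connected_iff_exists_forall_reachable]
    exact ⟨r, fun v => (exists_walk_parentGraph hρ v).choose.reachable.symm⟩
  refine SimpleGraph.isTree_iff_connected_and_card.2
    ⟨hconn, le_antisymm ?_ hconn.card_vert_le_card_edgeSet_add_one⟩
  have hsub : (parentGraph f).edgeSet ⊆ (fun v => s(v, f v)) '' {r}ᶜ := by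
    intro e
    induction e using Sym2.ind with
    | _ u v =>
      rw [SimpleGraph.mem_edgeSet, parentGraph_adj]
      rintro ⟨hne, h | h⟩
      · exact ⟨u, by rintro rfl; exact hne (hr.symm.trans h), by simp [h]⟩
      · exact ⟨v, by rintro rfl; exact hne (h.symm.trans hr), by simp [h, Sym2.eq_swap]⟩
  have h1 := (Set.ncard_le_ncard hsub).trans (Set.ncard_image_le (Set.toFinite _))
  have h2 := Set.ncard_add_ncard_compl {r}
  rw [Set.ncard_singleton] at h2
  rw [Nat.card_coe_set_eq]
  omega

theorem DescOf.exists_iterate (hρ : ∀ v, v ≠ r → ρ (f v) < ρ v) {u v : α}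
    (h : DescOf (parentGraph f) r v u) : ∃ k, f^[k] u = v := by
  obtain ⟨p, hp⟩ := exists_walk_parentGraph hρ u
  exact hp v (h.2.2 p)

/-- A ranked parent function is determined by its graph. -/
theorem eq_of_parentGraph_eq {g : α → α} (hρ : ∀ v, v ≠ r → ρ (f v) < ρ v) (hf : f r = r)
    (hg : g r = r) (h : parentGraph f = parentGraph g) : f = g := by
  funext v
  induction hk : ρ v using Nat.strong_induction_on generalizing v with
  | _ k ih =>
    by_cases hv : v = r
    · rw [hv, hf, hg]
    · have hlt := hρ v hv
      have hadj : (parentGraph f).Adj v (f v) := by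
        rw [parentGraph_adj]
        exact ⟨fun h => by rw [← h] at hlt; exact lt_irrefl _ hlt, Or.inl rfl⟩
      rw [h, parentGraph_adj] at hadj
      rcases hadj.2 with h1 | h1
      · exact h1.symm
      · have h2 := ih _ (hk ▸ hlt) (f v) rfl
        rw [h1] at h2
        by_cases hfv : f v = r
        · rw [hfv, hf] at h2
          exact absurd h2.symm hv
        · have := hρ _ hfv
          rw [h2] at this
          omega

end Rank

/-- A rooted tree comes from a parent function. -/
theorem SimpleGraph.IsTree.exists_parent {α : Type*} {T : SimpleGraph α} (hT : T.IsTree) (r : α) :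
    ∃ f : α → α, f r = r ∧ parentGraph f = T ∧
      (∀ v, v ≠ r → T.Adj v (f v) ∧ ∀ p : T.Walk v r, f v ∈ p.support) ∧
      ∀ v, v ≠ r → f v ≠ r → f (f v) ≠ v := by
  classical
  choose p hp huniq using fun v => hT.existsUnique_path v r
  have hnil : ∀ v, v ≠ r → ¬ (p v).Nil := fun v hv h => hv h.eq
  have hadj : ∀ v, v ≠ r → T.Adj v (p v).snd := fun v hv => (p v).adj_snd (hnil v hv)
  have hr : (p r).snd = r := by
    rw [← huniq r .nil .nil]; rfl
  refine ⟨fun v => (p v).snd, hr, ?_, fun v hv => ⟨hadj v hv, fun q => ?_⟩, fun v hv hfv h => ?_⟩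
  · ext u v
    rw [parentGraph_adj]
    constructor
    · rintro ⟨hne, h | h⟩
      · have : u ≠ r := by rintro rfl; exact hne (hr.symm.trans h)
        exact h ▸ hadj u this
      · have : v ≠ r := by rintro rfl; exact hne (h.symm.trans hr)
        exact (h ▸ hadj v this).symm
    · intro h
      refine ⟨h.ne, ?_⟩
      by_cases hv : v ∈ (p u).support
      · exact Or.inl (hT.isAcyclic.eq_snd_of_adj_start (hp u) h hv).symm
      · right
        have := huniq v (.cons h.symm (p u)) ((SimpleGraph.Walk.cons_isPath_iff _ _).2 ⟨hp u, hv⟩)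
        rw [← this]
        simp
  · have := huniq v q.bypass q.bypass_isPath
    apply q.support_bypass_subset_support
    rw [this]
    exact SimpleGraph.Walk.getVert_mem_support _ _
  · have htail := huniq (p v).snd (p v).tail (hp v).tail
    have h1 : v ∉ (p v).tail.support := by
      have h2 := hp v
      rw [← (p v).cons_tail_eq (hnil v hv), SimpleGraph.Walk.cons_isPath_iff] at h2
      exact h2.2
    apply h1
    have h2 : (p (p v).snd).snd ∈ (p (p v).snd).support :=
      SimpleGraph.Walk.getVert_mem_support _ _
    rw [htail]
    rwa [show (p (p v).snd).snd = v from h] at h2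

section IDTree

variable {V : Finset ℕ} {r : ℕ}

/-- The parent function on the vertices in `V`. -/
def idParentRestrict (f : idParent V r) (v : {x // x ∈ V}) : {x // x ∈ V} :=
  ⟨f.1 v, by
    by_cases h : (v : ℕ) = r
    · rw [f.2.1 v (Or.inr h)]; exact v.2
    · exact (f.2.2 v v.2 h).1⟩

/-- A rank which strictly decreases from every vertex to its parent. -/
def idRank (r : ℕ) (f : ℕ → ℕ) (v : ℕ) : ℕ :=
  if Even v then 2 * (r - v) else 2 * (r - f v) + 1

theorem idRank_lt (hmax : ∀ v ∈ V, v ≤ r) {f : ℕ → ℕ} (hf : f ∈ idParent V r) {v : ℕ}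
    (hv : v ∈ V) (hvr : v ≠ r) : idRank r f (f v) < idRank r f v := by
  have h := hf.2 v hv hvr
  have h1 := hmax v hv
  have h2 := hmax _ h.1
  rcases Nat.even_or_odd v with hv' | hv'
  · have h3 := h.2.2 hv'
    rw [idRank, idRank, if_neg (Nat.not_even_iff_odd.2 h3.1), if_pos hv']
    omega
  · have h3 := h.2.1 hv'
    rw [idRank, idRank, if_pos h3.1, if_neg (Nat.not_even_iff_odd.2 hv')]
    omega

/-- Even ancestors are larger than their descendants, odd ancestors are smaller. -/
theorem le_iterate_of_mem_idParent (hr : Even r) {f : ℕ → ℕ} (hf : f ∈ idParent V r) (k : ℕ)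
    {u : ℕ} (hu : u ∈ V) :
    (Even (f^[k] u) → u ≤ f^[k] u) ∧ (Odd (f^[k] u) → f^[k] u ≤ u) := by
  induction k using Nat.strong_induction_on generalizing u with
  | _ k ih =>
    have hfr : f r = r := hf.1 r (Or.inr rfl)
    rcases k with _ | k
    · simp
    by_cases hur : u = r
    · rw [hur, Function.iterate_fixed hfr]
      exact ⟨fun _ => le_rfl, fun _ => le_rfl⟩
    have h := hf.2 u hu hur
    have h1 := ih k (by omega) h.1
    rw [Function.iterate_succ_apply]
    rcases Nat.even_or_odd u with hu' | hu'
    · have h2 := h.2.2 hu'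
      refine ⟨fun he => ?_, fun ho => (h1.2 ho).trans h2.2.1.le⟩
      rcases k with _ | k
      · exact absurd he (Nat.not_even_iff_odd.2 h2.1)
      · have hfur : f u ≠ r := fun h => Nat.not_even_iff_odd.2 h2.1 (h ▸ hr)
        have h3 := ih k (by omega) (hf.2 _ h.1 hfur).1
        exact h2.2.2.le.trans (h3.1 he)
    · have h2 := h.2.1 hu'
      refine ⟨fun he => h2.2.1.le.trans (h1.1 he), fun ho => ?_⟩
      rcases k with _ | k
      · exact absurd h2.1 (Nat.not_even_iff_odd.2 ho)
      · by_cases hfur : f u = r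
        · rw [hfur, Function.iterate_fixed hfr] at ho
          exact absurd hr (Nat.not_even_iff_odd.2 ho)
        · have h3 := ih k (by omega) (hf.2 _ h.1 hfur).1
          exact (h3.2 ho).trans (h2.2.2.resolve_left hfur).le

theorem idParentRestrict_root (hr : r ∈ V) (f : idParent V r) :
    idParentRestrict f ⟨r, hr⟩ = ⟨r, hr⟩ :=
  Subtype.ext (f.2.1 r (Or.inr rfl))

theorem idRank_restrict_lt (hr : r ∈ V) (hmax : ∀ v ∈ V, v ≤ r) (f : idParent V r)
    (v : {x // x ∈ V}) (hv : v ≠ ⟨r, hr⟩) :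
    idRank r f.1 (idParentRestrict f v) < idRank r f.1 v :=
  idRank_lt hmax f.2 v.2 fun h => hv (Subtype.ext h)

theorem isIDTree_parentGraph (hr : r ∈ V) (hre : Even r) (hmax : ∀ v ∈ V, v ≤ r)
    (f : idParent V r) : IsIDTree V (parentGraph (idParentRestrict f)) := by
  have hrank := idRank_restrict_lt hr hmax f
  have htree := isTree_parentGraph (ρ := fun v : {x // x ∈ V} => idRank r f.1 v) hrank
    (idParentRestrict_root hr f)
  refine ⟨htree.connected, htree.isAcyclic, fun r' v _ hr' => ?_⟩
  have hrr : r' = ⟨r, hr⟩ :=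
    Subtype.ext (le_antisymm (hmax _ r'.2) (hr' ⟨r, hr⟩ (htree.connected _ _)))
  subst hrr
  have hiter : ∀ (k : ℕ) (u : {x // x ∈ V}),
      (((idParentRestrict f)^[k] u : {x // x ∈ V}) : ℕ) = f.1^[k] u := by
    intro k
    induction k with
    | zero => intro u; rfl
    | succ k ih => intro u; rw [Function.iterate_succ_apply, Function.iterate_succ_apply, ih]; rfl
  have hdesc : ∀ u, DescOf (parentGraph (idParentRestrict f)) ⟨r, hr⟩ v u →
      (Even (v : ℕ) → (u : ℕ) < v) ∧ (Odd (v : ℕ) → (v : ℕ) < u) := by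
    intro u hu
    obtain ⟨k, hk⟩ := hu.exists_iterate (ρ := fun v : {x // x ∈ V} => idRank r f.1 v) hrank
    have h := le_iterate_of_mem_idParent hre f.2 k u.2
    rw [← hiter, hk] at h
    have hne : (u : ℕ) ≠ v := fun h => hu.1 (Subtype.ext h)
    exact ⟨fun he => lt_of_le_of_ne (h.1 he) hne, fun ho => lt_of_le_of_ne (h.2 ho) hne.symm⟩
  have hpar : ∀ u, (parentGraph (idParentRestrict f)).Adj v u →
      (Odd (v : ℕ) → Even (u : ℕ)) ∧ (Even (v : ℕ) → Odd (u : ℕ)) := by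
    have aux : ∀ a b : {x // x ∈ V}, a ≠ b → idParentRestrict f a = b →
        (Odd (a : ℕ) → Even (b : ℕ)) ∧ (Even (a : ℕ) → Odd (b : ℕ)) := by
      intro a b hne hab
      have har : (a : ℕ) ≠ r := by
        intro h
        have h' : a = ⟨r, hr⟩ := Subtype.ext h
        rw [h', idParentRestrict_root hr f, ← h'] at hab
        exact hne hab
      have h := f.2.2 a a.2 har
      have hb : f.1 a = b := congrArg Subtype.val hab
      rw [hb] at h
      exact ⟨fun ho => (h.2.1 ho).1, fun he => (h.2.2 he).1⟩
    intro u hu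
    rw [parentGraph_adj] at hu
    rcases hu.2 with h | h
    · exact aux v u hu.1 h
    · have h1 := aux u v hu.1.symm h
      constructor
      · intro ho
        by_contra hc
        exact Nat.not_even_iff_odd.2 ho (h1.1 (Nat.not_even_iff_odd.1 hc))
      · intro he
        by_contra hc
        exact Nat.not_even_iff_odd.2 (h1.2 (Nat.not_odd_iff_even.1 hc)) he
  exact ⟨fun ho => ⟨fun u hu => (hdesc u hu).2 ho, fun u hu _ => (hpar u hu).1 ho⟩,
    fun he => ⟨fun u hu => (hdesc u hu).1 he, fun u hu _ => (hpar u hu).2 he⟩⟩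

theorem IsIDTree.exists_idParent (hr : r ∈ V) (hre : Even r) (hmax : ∀ v ∈ V, v ≤ r)
    {T : SimpleGraph {x // x ∈ V}} (hT : IsIDTree V T) :
    ∃ f : idParent V r, parentGraph (idParentRestrict f) = T := by
  have htree : T.IsTree := ⟨hT.1, hT.2.1⟩
  obtain ⟨g, hgr, hgT, hg, hgg⟩ := htree.exists_parent ⟨r, hr⟩
  have hid : ∀ w, _ := fun w => hT.2.2 ⟨r, hr⟩ w (hT.1 _ _) fun u _ => hmax u u.2
  have hne : ∀ v : {x // x ∈ V}, (v : ℕ) ≠ r → v ≠ ⟨r, hr⟩ := fun v hv h => hv (by rw [h])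
  have hdesc : ∀ v, v ≠ ⟨r, hr⟩ → DescOf T ⟨r, hr⟩ (g v) v := fun v hv =>
    ⟨(hg v hv).1.ne, hT.1 _ _, (hg v hv).2⟩
  have hdesc2 : ∀ v, v ≠ ⟨r, hr⟩ → g v ≠ ⟨r, hr⟩ → DescOf T ⟨r, hr⟩ (g (g v)) v :=
    fun v hv hgv => ⟨(hgg v hv hgv).symm, hT.1 _ _, fun p =>
      p.support_dropUntil_subset_support ((hg v hv).2 p) ((hg _ hgv).2 _)⟩
  have hodd : ∀ v : {x // x ∈ V}, v ≠ ⟨r, hr⟩ → Odd (v : ℕ) → Even (g v : ℕ) := by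
    intro v hv ho
    by_contra hc
    have := ((hid (g v)).1 (Nat.not_even_iff_odd.1 hc)).2 v (hg v hv).1.symm (hdesc v hv)
    exact Nat.not_even_iff_odd.2 ho this
  have heven : ∀ v : {x // x ∈ V}, v ≠ ⟨r, hr⟩ → Even (v : ℕ) → Odd (g v : ℕ) := by
    intro v hv he
    by_contra hc
    have := ((hid (g v)).2 (Nat.not_odd_iff_even.1 hc)).2 v (hg v hv).1.symm (hdesc v hv)
    exact Nat.not_even_iff_odd.2 this he
  let f : ℕ → ℕ := fun v => if h : v ∈ V then g ⟨v, h⟩ else v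
  have hfg : ∀ v : {x // x ∈ V}, f v = g v := fun v => dif_pos v.2
  have hf : f ∈ idParent V r := by
    refine ⟨fun v hv => ?_, fun v hv hvr => ?_⟩
    · by_cases hvV : v ∈ V
      · obtain rfl : v = r := hv.resolve_left fun h => h hvV
        exact (hfg ⟨v, hvV⟩).trans (congrArg Subtype.val hgr)
      · exact dif_neg hvV
    · obtain ⟨w, rfl⟩ : ∃ w : {x // x ∈ V}, (w : ℕ) = v := ⟨⟨v, hv⟩, rfl⟩
      have hw := hne w hvr
      rw [hfg, hfg]
      refine ⟨(g w).2, fun ho => ?_, fun he => ?_⟩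
      · have h1 := hodd w hw ho
        refine ⟨h1, ((hid (g w)).2 h1).1 w (hdesc w hw), ?_⟩
        by_cases hgw : g w = ⟨r, hr⟩
        · exact Or.inl (congrArg Subtype.val hgw)
        · exact Or.inr (((hid _).1 (heven _ hgw h1)).1 w (hdesc2 w hw hgw))
      · have h1 := heven w hw he
        have hgw : g w ≠ ⟨r, hr⟩ := by
          intro h
          rw [h] at h1
          exact Nat.not_even_iff_odd.2 h1 hre
        exact ⟨h1, ((hid (g w)).1 h1).1 w (hdesc w hw),
          ((hid _).2 (hodd _ hgw h1)).1 w (hdesc2 w hw hgw)⟩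
  refine ⟨⟨f, hf⟩, ?_⟩
  rw [← hgT]
  congr 1
  funext v
  exact Subtype.ext (hfg v)

theorem card_isIDTree (hr : r ∈ V) (hre : Even r) (hmax : ∀ v ∈ V, v ≤ r) :
    Nat.card {T : SimpleGraph {x // x ∈ V} // IsIDTree V T} = Nat.card (idParent V r) := by
  symm
  refine Nat.card_eq_of_bijective (fun f => ⟨parentGraph (idParentRestrict f),
    isIDTree_parentGraph hr hre hmax f⟩) ⟨fun f g h => ?_, fun T => ?_⟩
  · have h' := eq_of_parentGraph_eq (ρ := fun v : {x // x ∈ V} => idRank r f.1 v)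
      (idRank_restrict_lt hr hmax f) (idParentRestrict_root hr f) (idParentRestrict_root hr g)
      (congrArg Subtype.val h)
    ext v
    by_cases hv : v ∈ V
    · exact congrArg Subtype.val (congrFun h' ⟨v, hv⟩)
    · rw [f.2.1 v (Or.inl hv), g.2.1 v (Or.inl hv)]
  · obtain ⟨f, hf⟩ := T.2.exists_idParent hr hre hmax
    exact ⟨f, Subtype.ext hf⟩

end IDTree

/-- The number of ID trees with vertex set `[2n]` is the Genocchi number `g_n`,
the number of Dumont permutations on `[2n-2]`. -/
theorem stmt3 (n : ℕ) (hn : 1 ≤ n) :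
    Nat.card {T : SimpleGraph {x // x ∈ Finset.Icc 1 (2 * n)} //
        IsIDTree (Finset.Icc 1 (2 * n)) T} = genocchi n := by
  have h := card_idParent_eq_coeff n (2 * n) ∅ (by simp) (by simp; omega) (by simp)
  rw [card_empty, pow_zero, ← genocchi_eq_coeff n hn, union_empty] at h
  rw [card_isIDTree (r := 2 * n) (by simp; omega) (by simp) fun v hv => (mem_Icc.1 hv).2]
  exact_mod_cast h
end

section
/- For all n ≥ 1, the number of ID forests with vertex set [2n] = {1,2,...,2n} equals the median Genocchi number h_n, i.e., equals the number of Dumont derangements on [2n+2]. -/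
open Finset

/-! ### Zigzag maps -/

/-- A self-map `P` such that `P` moves up from the vertices in `o` and down from the others, while
`P ∘ P` moves in the opposite direction. -/
def IsZigzag {α : Type*} [LE α] (o : α → Prop) (P : α → α) : Prop :=
  ∀ i, (o i → i ≤ P i ∧ P (P i) ≤ i) ∧ (¬ o i → P i ≤ i ∧ i ≤ P (P i))

/-- The graph whose edges join each non-fixed point of `P` to its image. -/
def zigzagGraph {α : Type*} (P : α → α) : SimpleGraph α :=
  SimpleGraph.fromRel (fun a b => P a = b)

lemma zigzagGraph_adj {α : Type*} {P : α → α} {a b : α} :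
    (zigzagGraph P).Adj a b ↔ a ≠ b ∧ (P a = b ∨ P b = a) := by
  simp [zigzagGraph]

namespace IsZigzag

variable {α : Type*} [LinearOrder α] {o : α → Prop} {P Q : α → α}

lemma mem_apply_iff (h : IsZigzag o P) {i : α} (hi : P i ≠ i) : o (P i) ↔ ¬ o i := by
  have h1 := h i
  have h2 := h (P i)
  constructor
  · intro hp ho
    exact hi (le_antisymm ((h2.1 hp).1.trans (h1.1 ho).2) (h1.1 ho).1)
  · intro ho
    by_contra hp
    exact hi (le_antisymm (h1.2 ho).1 ((h1.2 ho).2.trans (h2.2 hp).1))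

lemma adj (h : IsZigzag o P) {a b : α} (hab : (zigzagGraph P).Adj a b) :
    (o a → ¬ o b ∧ a < b) ∧ (¬ o a → o b ∧ b < a) := by
  obtain ⟨hne, rfl | rfl⟩ := zigzagGraph_adj.1 hab
  · have := h.mem_apply_iff hne.symm
    exact ⟨fun ha => ⟨by tauto, ((h a).1 ha).1.lt_of_ne hne⟩,
      fun ha => ⟨by tauto, ((h a).2 ha).1.lt_of_ne hne.symm⟩⟩
  · have := h.mem_apply_iff hne
    exact ⟨fun ha => ⟨by tauto, ((h b).2 (by tauto)).1.lt_of_ne hne⟩,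
      fun ha => ⟨by tauto, ((h b).1 (by tauto)).1.lt_of_ne hne.symm⟩⟩

lemma adj_le (h : IsZigzag o P) {a b : α} (hab : (zigzagGraph P).Adj a b) :
    (o a → b ≤ P a) ∧ (¬ o a → P a ≤ b) := by
  have hadj := h.adj hab
  obtain ⟨hne, rfl | rfl⟩ := zigzagGraph_adj.1 hab
  · exact ⟨fun _ => le_rfl, fun _ => le_rfl⟩
  · exact ⟨fun ha => ((h b).2 (hadj.1 ha).1).2, fun ha => ((h b).1 (hadj.2 ha).1).2⟩

omit [LinearOrder α] in
lemma adj_apply {i : α} (hi : P i ≠ i) : (zigzagGraph P).Adj i (P i) :=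
  zigzagGraph_adj.2 ⟨hi.symm, Or.inl rfl⟩

lemma not_adj_of_apply_eq (h : IsZigzag o P) {a b : α} (ha : P a = a) :
    ¬ (zigzagGraph P).Adj a b := by
  intro hab
  have h1 := h.adj hab
  have h2 := h.adj_le hab
  rw [ha] at h2
  by_cases ho : o a
  · exact ((h1.1 ho).2.trans_le (h2.1 ho)).false
  · exact ((h1.2 ho).2.trans_le (h2.2 ho)).false

lemma eq_of_graph_eq (hP : IsZigzag o P) (hQ : IsZigzag o Q)
    (h : zigzagGraph P = zigzagGraph Q) : P = Q := by
  have key : ∀ {P Q : α → α}, IsZigzag o P → IsZigzag o Q → zigzagGraph P = zigzagGraph Q →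
      ∀ i, (o i → P i ≤ Q i) ∧ (¬ o i → Q i ≤ P i) := by
    intro P Q hP hQ h i
    by_cases hi : P i = i
    · rw [hi]
      exact ⟨fun ho => ((hQ i).1 ho).1, fun ho => ((hQ i).2 ho).1⟩
    · exact hQ.adj_le (h ▸ adj_apply hi)
  funext i
  have h1 := key hP hQ h i
  have h2 := key hQ hP h.symm i
  by_cases ho : o i
  · exact le_antisymm (h1.1 ho) (h2.1 ho)
  · exact le_antisymm (h2.2 ho) (h1.2 ho)

end IsZigzag

/-- A graph is acyclic if, for some rank function, each vertex is adjacent to at most one vertex of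
at least the same rank, namely its image under `P`. -/
lemma SimpleGraph.isAcyclic_of_rank {α β : Type*} [LinearOrder β] {G : SimpleGraph α} (P : α → α)
    (rank : α → β)
    (h : ∀ a b, G.Adj a b → rank a ≤ rank b → P a = b) : G.IsAcyclic := by
  classical
  intro v c hc
  obtain ⟨x, hx, hmin⟩ := Set.exists_min_image {x | x ∈ c.support} rank
    (List.finite_toSet _) ⟨v, c.start_mem_support⟩
  have hc' := hc.rotate hx
  have hmem : ∀ y, y ∈ (c.rotate x hx).support → rank x ≤ rank y := fun y hy =>
    hmin y ((SimpleGraph.Walk.mem_support_rotate_iff _ _ hx).1 hy)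
  have h1 := h x _ ((c.rotate x hx).adj_snd hc'.not_nil)
    (hmem _ (SimpleGraph.Walk.getVert_mem_support _ _))
  have h2 := h x _ ((c.rotate x hx).adj_penultimate hc'.not_nil).symm
    (hmem _ (SimpleGraph.Walk.getVert_mem_support _ _))
  exact hc'.snd_ne_penultimate (h1.symm.trans h2)

section DescOf

variable {α : Type*} {G : SimpleGraph α} {r a b c : α}

lemma not_descOf_root : ¬ DescOf G r a r := fun h =>
  h.1 (by simpa [eq_comm] using h.2.2 SimpleGraph.Walk.nil)

/-- A neighbour of a descendant of `a`, other than `a` itself, is a descendant of `a`. -/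
lemma DescOf.of_adj_s4 (h : DescOf G r a b) (hbc : G.Adj b c) (hc : c ≠ a) : DescOf G r a c :=
  ⟨hc, hbc.symm.reachable.trans h.2.1, fun p => by
    have := h.2.2 (SimpleGraph.Walk.cons hbc p)
    simpa [h.1.symm] using this⟩

lemma SimpleGraph.IsAcyclic.descOf_or_descOf_s4 (hG : G.IsAcyclic) (hab : G.Adj a b)
    (hr : G.Reachable a r) : DescOf G r a b ∨ DescOf G r b a := by
  classical
  by_contra! hcon
  obtain ⟨h1, h2⟩ := hcon
  simp only [DescOf, not_and, not_forall] at h1 h2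
  obtain ⟨p, hp⟩ := h1 hab.ne' (hab.symm.reachable.trans hr)
  obtain ⟨q, hq⟩ := h2 hab.ne hr
  have := SimpleGraph.isBridge_iff_forall_walk_mem_edges.1
    (SimpleGraph.isAcyclic_iff_forall_adj_isBridge.1 hG hab) (q.append p.reverse)
  rw [SimpleGraph.Walk.edges_append, List.mem_append, SimpleGraph.Walk.edges_reverse,
    List.mem_reverse] at this
  rcases this with h | h
  · exact hq (q.snd_mem_support_of_mem_edges h)
  · exact hp (p.fst_mem_support_of_mem_edges h)

end DescOf

section Forest

variable {V : Finset ℕ}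

lemma IsZigzag.isAcyclic {P : {x // x ∈ V} → {x // x ∈ V}} (h : IsZigzag (fun i : {x // x ∈ V} => Odd (i : ℕ)) P) :
    (zigzagGraph P).IsAcyclic := by
  classical
  refine SimpleGraph.isAcyclic_of_rank P
    (fun i => if Odd (i : ℕ) then 2 * (P i : ℕ) else 2 * (i : ℕ) + 1) fun a b hab hr => ?_
  have hadj := h.adj hab
  obtain ⟨hne, h1 | rfl⟩ := zigzagGraph_adj.1 hab
  · exact h1
  by_cases hb : Odd (b : ℕ)
  · have ha : ¬ Odd (P b : ℕ) := fun ha => (hadj.1 ha).1 hb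
    rw [if_neg ha, if_pos hb] at hr
    omega
  · have ha : Odd (P b : ℕ) := by
      by_contra ha
      exact hb (hadj.2 ha).1
    rw [if_pos ha, if_neg hb] at hr
    have hle : (b : ℕ) ≤ P (P b) := ((h b).2 hb).2
    exact Subtype.ext (by omega)

lemma IsZigzag.eq_root {P : {x // x ∈ V} → {x // x ∈ V}} (h : IsZigzag (fun i : {x // x ∈ V} => Odd (i : ℕ)) P)
    {r y : {x // x ∈ V}} (hy : ¬ Odd (y : ℕ)) (hyy : P (P y) = y)
    (hr : (zigzagGraph P).Reachable y r)
    (hmax : ∀ u, (zigzagGraph P).Reachable y u → (u : ℕ) ≤ r) : y = r := by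
  have hP : ∀ i, (zigzagGraph P).Reachable i (P i) := fun i => by
    by_cases hi : P i = i
    · rw [hi]
    · exact (IsZigzag.adj_apply hi).reachable
  have hiter : ∀ x, (zigzagGraph P).Reachable y x → ∃ k, P^[k] x = y := by
    intro x hx
    rw [SimpleGraph.reachable_iff_reflTransGen] at hx
    induction hx with
    | refl => exact ⟨0, rfl⟩
    | @tail x z _ hxz ih =>
      obtain ⟨k, hk⟩ := ih
      obtain ⟨-, hz | hz⟩ := zigzagGraph_adj.1 hxz
      · cases k with
        | zero => exact ⟨1, by simp_all⟩
        | succ k => exact ⟨k, by rwa [← hz, ← Function.iterate_succ_apply]⟩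
      · exact ⟨k + 1, by rwa [Function.iterate_succ_apply, hz]⟩
  have hPr : ∀ i, P^[i] r = r ∨ P^[i] r = P r := by
    have hPP : P r = r ∨ P (P r) = r := by
      by_cases ho : Odd (r : ℕ)
      · exact Or.inl (le_antisymm (hmax _ (hr.trans (hP r))) ((h r).1 ho).1)
      · exact Or.inr (le_antisymm (hmax _ ((hr.trans (hP r)).trans (hP _))) ((h r).2 ho).2)
    intro i
    induction i with
    | zero => exact Or.inl rfl
    | succ i ih =>
      rw [Function.iterate_succ_apply']
      rcases ih with ih | ih <;> rw [ih] <;> rcases hPP with e | e <;> simp [e]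
  obtain ⟨k, hk⟩ := hiter r hr
  rcases hPr k with e | e
  · exact hk.symm.trans e
  have hyr : y = P r := hk.symm.trans e
  by_contra hne
  have hPr' : P r ≠ r := fun e' => hne (hyr.trans e')
  have ho : Odd (r : ℕ) := by
    by_contra ho
    exact hy (hyr ▸ (h.mem_apply_iff hPr').2 ho)
  exact hPr' (le_antisymm (hmax _ (hr.trans (hP r))) ((h r).1 ho).1)

lemma IsZigzag.isIDForest {P : {x // x ∈ V} → {x // x ∈ V}} (h : IsZigzag (fun i : {x // x ∈ V} => Odd (i : ℕ)) P) :
    IsIDForest V (zigzagGraph P) := by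
  refine ⟨h.isAcyclic, fun r v hvr hmax => ?_⟩
  have hmove : ∀ u, DescOf (zigzagGraph P) r v u →
      P u ≠ u ∧ (P u ≠ v → DescOf (zigzagGraph P) r v (P u)) := by
    intro u hu
    have hne : P u ≠ u := by
      intro hPu
      obtain ⟨p⟩ := hu.2.1
      cases p with
      | nil => exact not_descOf_root hu
      | cons hadj _ => exact h.not_adj_of_apply_eq hPu hadj
    exact ⟨hne, fun hv => hu.of_adj_s4 (IsZigzag.adj_apply hne) hv⟩
  have hroot : ∀ u : {x // x ∈ V}, ¬ Odd (u : ℕ) → DescOf (zigzagGraph P) r v u → P (P u) ≠ u := by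
    intro u ho hu hPu
    have : u = r := h.eq_root ho hPu hu.2.1
      fun w hw => hmax w ((hvr.trans hu.2.1.symm).trans hw)
    exact not_descOf_root (this ▸ hu)
  refine ⟨fun hv => ⟨?_, fun u hu _ => ?_⟩, fun hv => ⟨?_, fun u hu _ => ?_⟩⟩
  · have key : ∀ k, ∀ u : {x // x ∈ V}, (u : ℕ) = k → Odd (u : ℕ) →
        DescOf (zigzagGraph P) r v u → v < u := by
      intro k
      induction k using Nat.strong_induction_on with
      | _ k ih =>
        intro u hk ho hu
        obtain ⟨h1, h2⟩ := hmove u hu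
        have ho' := (not_congr (h.mem_apply_iff h1)).2 (not_not.2 ho)
        have hD := h2 (fun e => ho' (e ▸ hv))
        obtain ⟨h3, h4⟩ := hmove _ hD
        have hlt : P (P u) < u := ((h u).1 ho).2.lt_of_ne fun e => hroot _ ho' hD (by rw [e])
        by_cases e : P (P u) = v
        · exact e ▸ hlt
        · exact (ih _ (hk ▸ hlt) _ rfl ((h.mem_apply_iff h3).2 ho') (h4 e)).trans hlt
    intro u hu
    by_cases ho : Odd (u : ℕ)
    · exact key _ u rfl ho hu
    · obtain ⟨h1, h2⟩ := hmove u hu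
      have hlt : P u < u := ((h u).2 ho).1.lt_of_ne h1
      by_cases e : P u = v
      · exact e ▸ hlt
      · exact (key _ _ rfl ((h.mem_apply_iff h1).2 ho) (h2 e)).trans hlt
  · exact Nat.not_odd_iff_even.1 ((h.adj hu).1 hv).1
  · rw [← Nat.not_odd_iff_even] at hv
    obtain ⟨N, hN⟩ : ∃ N, ∀ x ∈ V, x ≤ N := ⟨V.sup id, fun x hx => Finset.le_sup (f := id) hx⟩
    have key : ∀ k, ∀ u : {x // x ∈ V}, N - (u : ℕ) = k → ¬ Odd (u : ℕ) →
        DescOf (zigzagGraph P) r v u → u < v := by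
      intro k
      induction k using Nat.strong_induction_on with
      | _ k ih =>
        intro u hk ho hu
        obtain ⟨h1, h2⟩ := hmove u hu
        have ho' := (h.mem_apply_iff h1).2 ho
        have hD := h2 (fun e => hv (e ▸ ho'))
        obtain ⟨h3, h4⟩ := hmove _ hD
        have hlt : u < P (P u) := ((h u).2 ho).2.lt_of_ne fun e => hroot _ ho hu e.symm
        by_cases e : P (P u) = v
        · exact e ▸ hlt
        · have hlt' : (u : ℕ) < P (P u) := hlt
          have := hN _ (P (P u)).2
          exact hlt.trans (ih _ (by omega) _ rfl
            ((not_congr (h.mem_apply_iff h3)).2 (not_not.2 ho')) (h4 e))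
    intro u hu
    by_cases ho : Odd (u : ℕ)
    · obtain ⟨h1, h2⟩ := hmove u hu
      have hlt : u < P u := ((h u).1 ho).1.lt_of_ne' h1
      by_cases e : P u = v
      · exact e ▸ hlt
      · exact hlt.trans (key _ _ rfl ((not_congr (h.mem_apply_iff h1)).2 (not_not.2 ho)) (h2 e))
    · exact key _ u rfl ho hu
  · exact ((h.adj hu).2 (Nat.not_odd_iff_even.2 hv)).1

lemma IsIDForest.exists_isZigzag {F : SimpleGraph {x // x ∈ V}} (h : IsIDForest V F) :
    ∃ P, IsZigzag (fun i : {x // x ∈ V} => Odd (i : ℕ)) P ∧ zigzagGraph P = F := by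
  obtain ⟨hac, hF⟩ := h
  have hroot : ∀ a, ∃ r, F.Reachable a r ∧ ∀ u, F.Reachable a u → (u : ℕ) ≤ r := fun a =>
    Set.exists_max_image {u | F.Reachable a u} (fun u => (u : ℕ)) (Set.toFinite _)
      ⟨a, SimpleGraph.Reachable.refl a⟩
  -- the child `b` of `a` together with all its other neighbours lies below `a`
  have hedge : ∀ a b, F.Adj a b → ∃ r,
      (DescOf F r a b ∨ DescOf F r b a) ∧ ∀ v, v = a ∨ v = b →
        (Odd (v : ℕ) → (∀ u, DescOf F r v u → (v : ℕ) < u) ∧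
          (∀ u, F.Adj v u → DescOf F r v u → Even (u : ℕ))) ∧
        (Even (v : ℕ) → (∀ u, DescOf F r v u → (u : ℕ) < v) ∧
          (∀ u, F.Adj v u → DescOf F r v u → Odd (u : ℕ))) := by
    intro a b hab
    obtain ⟨r, hr, hmax⟩ := hroot a
    refine ⟨r, hac.descOf_or_descOf_s4 hab hr, ?_⟩
    rintro v (rfl | rfl)
    · exact hF r _ hr hmax
    · exact hF r _ (hab.symm.reachable.trans hr)
        fun u hu => hmax u (hab.reachable.trans hu)
  have hpar : ∀ a b, F.Adj a b → (Odd (a : ℕ) → Even (b : ℕ) ∧ a < b) ∧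
      (Even (a : ℕ) → Odd (b : ℕ) ∧ b < a) := by
    intro a b hab
    obtain ⟨r, hd | hd, hv⟩ := hedge a b hab
    · have := hv a (Or.inl rfl)
      exact ⟨fun ha => ⟨(this.1 ha).2 b hab hd, (this.1 ha).1 b hd⟩,
        fun ha => ⟨(this.2 ha).2 b hab hd, (this.2 ha).1 b hd⟩⟩
    · have := hv b (Or.inr rfl)
      rcases Nat.even_or_odd (b : ℕ) with hb | hb
      · have ha := (this.2 hb).2 a hab.symm hd
        exact ⟨fun _ => ⟨hb, (this.2 hb).1 a hd⟩, fun ha' => absurd ha (Nat.not_odd_iff_even.2 ha')⟩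
      · have ha := (this.1 hb).2 a hab.symm hd
        exact ⟨fun ha' => absurd ha' (Nat.not_odd_iff_even.2 ha), fun _ => ⟨hb, (this.1 hb).1 a hd⟩⟩
  have hext : ∀ a b, F.Adj a b → Odd (a : ℕ) →
      (∀ w, F.Adj a w → w ≤ b) ∨ (∀ w, F.Adj b w → a ≤ w) := by
    intro a b hab ha
    have hb := ((hpar a b hab).1 ha).1
    obtain ⟨r, hd | hd, hv⟩ := hedge a b hab
    · refine Or.inr fun w hw => ?_
      by_cases e : w = a
      · exact e.ge
      · exact (((hv a (Or.inl rfl)).1 ha).1 w (hd.of_adj_s4 hw e)).le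
    · refine Or.inl fun w hw => ?_
      by_cases e : w = b
      · exact e.le
      · exact (((hv b (Or.inr rfl)).2 hb).1 w (hd.of_adj_s4 hw e)).le
  have hP : ∀ a, ∃ p, (p = a ∨ F.Adj a p) ∧ (Odd (a : ℕ) → ∀ w, F.Adj a w → w ≤ p) ∧
      (¬ Odd (a : ℕ) → ∀ w, F.Adj a w → p ≤ w) := by
    intro a
    by_cases ha : Odd (a : ℕ)
    · obtain ⟨p, hp, hmax⟩ := Set.exists_max_image {w | w = a ∨ F.Adj a w} id (Set.toFinite _)
        ⟨a, Or.inl rfl⟩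
      exact ⟨p, hp, fun _ w hw => hmax w (Or.inr hw), fun ha' => absurd ha ha'⟩
    · obtain ⟨p, hp, hmin⟩ := Set.exists_min_image {w | w = a ∨ F.Adj a w} id (Set.toFinite _)
        ⟨a, Or.inl rfl⟩
      exact ⟨p, hp, fun ha' => absurd ha' ha, fun _ w hw => hmin w (Or.inr hw)⟩
  choose P hP hodd heven using hP
  have hfix : ∀ a b, F.Adj a b → P a ≠ a := by
    intro a b hab e
    by_cases ha : Odd (a : ℕ)
    · exact (((hpar a b hab).1 ha).2.trans_le (e ▸ hodd a ha b hab)).false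
    · exact (((hpar a b hab).2 (Nat.not_odd_iff_even.1 ha)).2.trans_le
        (e ▸ heven a ha b hab)).false
  refine ⟨P, fun i => ?_, ?_⟩
  · rcases hP i with e | hadj
    · simp [e]
    · refine ⟨fun hi => ?_, fun hi => ?_⟩
      · obtain ⟨h1, h2⟩ := (hpar _ _ hadj).1 hi
        exact ⟨h2.le, heven _ (Nat.not_odd_iff_even.2 h1) _ hadj.symm⟩
      · obtain ⟨h1, h2⟩ := (hpar _ _ hadj).2 (Nat.not_odd_iff_even.1 hi)
        exact ⟨h2.le, hodd _ h1 _ hadj.symm⟩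
  · have key : ∀ a b, F.Adj a b → Odd (a : ℕ) → P a = b ∨ P b = a := by
      intro a b hab ha
      have hb := Nat.not_odd_iff_even.2 ((hpar a b hab).1 ha).1
      rcases hext a b hab ha with h | h
      · exact Or.inl (le_antisymm (h _ ((hP a).resolve_left (hfix a b hab))) (hodd a ha b hab))
      · exact Or.inr (le_antisymm (heven b hb a hab.symm)
          (h _ ((hP b).resolve_left (hfix b a hab.symm))))
    ext a b
    rw [zigzagGraph_adj]
    constructor
    · rintro ⟨hne, rfl | rfl⟩
      · exact (hP a).resolve_left hne.symm
      · exact ((hP b).resolve_left hne).symm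
    · intro hab
      refine ⟨hab.ne, ?_⟩
      by_cases ha : Odd (a : ℕ)
      · exact key a b hab ha
      · exact (key b a hab.symm ((hpar a b hab).2 (Nat.not_odd_iff_even.1 ha)).1).symm

/-- ID forests on `V` correspond to zigzag maps on `V`. -/
lemma card_isIDForest (V : Finset ℕ) :
    Nat.card {F : SimpleGraph {x // x ∈ V} // IsIDForest V F} =
      Nat.card {P : {x // x ∈ V} → {x // x ∈ V} // IsZigzag (fun i : {x // x ∈ V} => Odd (i : ℕ)) P} := by
  refine (Nat.card_congr (Equiv.ofBijective
    (fun P => ⟨zigzagGraph P.1, P.2.isIDForest⟩) ⟨fun P Q hPQ => ?_, fun F => ?_⟩)).symm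
  · exact Subtype.ext (P.2.eq_of_graph_eq Q.2 (congrArg Subtype.val hPQ))
  · obtain ⟨P, hP, hF⟩ := F.2.exists_isZigzag
    exact ⟨⟨P, hP⟩, Subtype.ext hF⟩

end Forest

/-! ### Counting by extending a map one value at a time -/

section Extension

open scoped Classical

variable {m N : ℕ}

lemma card_filter_forall_ne {S : Finset (Fin m → Fin (N + 1))} {T : Finset (Fin m → Fin N)}
    (c : Fin (N + 1)) (h : ∀ p, c.succAbove ∘ p ∈ S ↔ p ∈ T) :
    #{p ∈ S | ∀ i, p i ≠ c} = #T := by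
  have : ({p ∈ S | ∀ i, p i ≠ c} : Finset _) = T.image (c.succAbove ∘ ·) := by
    ext p
    simp only [mem_filter, mem_image]
    constructor
    · rintro ⟨hp, hc⟩
      choose q hq using fun i => Fin.exists_succAbove_eq (hc i)
      obtain rfl : c.succAbove ∘ q = p := funext hq
      exact ⟨q, (h q).1 hp, rfl⟩
    · rintro ⟨q, hq, rfl⟩
      exact ⟨(h q).2 hq, fun i => Fin.succAbove_ne c _⟩
  rw [this, card_image_of_injective]
  exact fun p q hpq => funext fun i => Fin.succAbove_right_injective (congrFun hpq i)

lemma card_eq_sum_snoc {S : Finset (Fin (m + 1) → Fin N)} {T : Finset (Fin m → Fin N)}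
    {R : (Fin m → Fin N) → Fin N → Prop}
    (h : ∀ q c, (Fin.snoc q c : Fin (m + 1) → Fin N) ∈ S ↔ q ∈ T ∧ R q c) :
    #S = ∑ c, #{q ∈ T | R q c} := by
  rw [card_eq_sum_card_fiberwise (f := fun p => p (Fin.last m)) (t := univ)
    (fun _ _ => mem_coe.2 (mem_univ _))]
  refine sum_congr rfl fun c _ => card_nbij' Fin.init (fun q => Fin.snoc q c) ?_ ?_ ?_ ?_
  · intro p hp
    obtain ⟨hp, rfl⟩ := mem_filter.1 (mem_coe.1 hp)
    exact mem_coe.2 (mem_filter.2 ((h _ _).1 (by simpa using hp)))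
  · intro q hq
    exact mem_coe.2 (mem_filter.2 ⟨(h _ _).2 (mem_filter.1 (mem_coe.1 hq)), by simp⟩)
  · intro p hp
    obtain ⟨hp, rfl⟩ := mem_filter.1 (mem_coe.1 hp)
    simp
  · intro q _
    simp

lemma succAbove_val_of_lt {c : Fin (N + 1)} (hc : m ≤ c) {a : Fin N} (ha : (a : ℕ) < m) :
    (c.succAbove a : ℕ) = a := by
  rw [Fin.succAbove_of_castSucc_lt _ _ (Fin.lt_def.2 (by simp; omega))]
  simp

lemma le_succAbove_val {c : Fin (N + 1)} {a : Fin N} : (a : ℕ) ≤ c.succAbove a := by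
  rw [Fin.succAbove]
  split_ifs <;> simp

lemma succAbove_val_of_succAbove_lt {c : Fin (N + 1)} (hc : m ≤ c) {a : Fin N}
    (ha : (c.succAbove a : ℕ) < m) : (c.succAbove a : ℕ) = a :=
  succAbove_val_of_lt hc (le_succAbove_val.trans_lt ha)

/-- Maps on `Fin m` satisfying the zigzag conditions, where values at least `m` are thought of as
not yet determined. -/
def IsPartialZigzag (p : Fin m → Fin N) : Prop :=
  ∀ i : Fin m, (Even (i : ℕ) → (i : ℕ) ≤ p i) ∧ (¬ Even (i : ℕ) → (p i : ℕ) ≤ i) ∧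
    ∀ j : Fin m, (p i : ℕ) = j →
      (Even (i : ℕ) → (p j : ℕ) ≤ i) ∧ (¬ Even (i : ℕ) → (i : ℕ) ≤ p j)

/-- The finset of partial zigzag maps. -/
noncomputable def partialZigzags (m N : ℕ) : Finset (Fin m → Fin N) :=
  {p | IsPartialZigzag p}

/-- Injective maps on `Fin m` which strictly increase even numbers and strictly decrease odd
numbers. -/
def IsPartialDerangement (p : Fin m → Fin N) : Prop :=
  Function.Injective p ∧
    ∀ i : Fin m, (Even (i : ℕ) → (i : ℕ) < p i) ∧ (¬ Even (i : ℕ) → (p i : ℕ) < i)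

/-- The finset of partial derangements. -/
noncomputable def partialDerangements (m N : ℕ) : Finset (Fin m → Fin N) :=
  {p | IsPartialDerangement p}

lemma mem_partialZigzags {p : Fin m → Fin N} : p ∈ partialZigzags m N ↔ IsPartialZigzag p := by
  simp [partialZigzags]

lemma mem_partialDerangements {p : Fin m → Fin N} :
    p ∈ partialDerangements m N ↔ IsPartialDerangement p := by
  simp [partialDerangements]

lemma succAbove_comp_mem_partialZigzags {c : Fin (N + 1)} (hc : m ≤ c) (p : Fin m → Fin N) :
    c.succAbove ∘ p ∈ partialZigzags m (N + 1) ↔ p ∈ partialZigzags m N := by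
  simp only [mem_partialZigzags, IsPartialZigzag, Function.comp_apply]
  have h1 : ∀ i, (p i : ℕ) < m → (c.succAbove (p i) : ℕ) = p i := fun i => succAbove_val_of_lt hc
  have h2 : ∀ i, (c.succAbove (p i) : ℕ) < m → (c.succAbove (p i) : ℕ) = p i :=
    fun i => succAbove_val_of_succAbove_lt hc
  have h3 : ∀ i, (p i : ℕ) ≤ c.succAbove (p i) := fun i => le_succAbove_val
  refine forall_congr' fun i => and_congr ?_ (and_congr ?_ (forall_congr' fun j => ?_))
  · have := h1 i; have := h2 i; have := h3 i; have := i.2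
    refine imp_congr_right fun _ => by omega
  · have := h1 i; have := h2 i; have := h3 i; have := i.2
    refine imp_congr_right fun _ => by omega
  · have := h1 i; have := h2 i; have := h3 i; have := i.2
    have := h1 j; have := h2 j; have := h3 j; have := j.2
    refine imp_congr (by omega) (and_congr (imp_congr_right fun _ => by omega)
      (imp_congr_right fun _ => by omega))

lemma succAbove_comp_mem_partialDerangements {c : Fin (N + 1)} (hc : m ≤ c) (p : Fin m → Fin N) :
    c.succAbove ∘ p ∈ partialDerangements m (N + 1) ↔ p ∈ partialDerangements m N := by
  simp only [mem_partialDerangements, IsPartialDerangement, Function.comp_apply]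
  refine and_congr (Fin.succAbove_right_injective.of_comp_iff p) (forall_congr' fun i => ?_)
  have h1 : (p i : ℕ) < m → (c.succAbove (p i) : ℕ) = p i := succAbove_val_of_lt hc
  have h2 : (c.succAbove (p i) : ℕ) < m → (c.succAbove (p i) : ℕ) = p i :=
    succAbove_val_of_succAbove_lt hc
  have h3 : (p i : ℕ) ≤ c.succAbove (p i) := le_succAbove_val
  have := i.2
  exact and_congr (imp_congr_right fun _ => by omega) (imp_congr_right fun _ => by omega)

lemma isPartialDerangement_snoc {q : Fin m → Fin N} {c : Fin N} :
    IsPartialDerangement (Fin.snoc q c : Fin (m + 1) → Fin N) ↔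
      IsPartialDerangement q ∧ (∀ i, q i ≠ c) ∧ (Even m → m < c) ∧ (¬ Even m → (c : ℕ) < m) := by
  rw [IsPartialDerangement, Fin.snoc_injective_iff, IsPartialDerangement]
  simp [Fin.forall_fin_succ']
  tauto

lemma isPartialZigzag_snoc_of_even (hm : Even m) {q : Fin m → Fin N} {c : Fin N} :
    IsPartialZigzag (Fin.snoc q c : Fin (m + 1) → Fin N) ↔
      IsPartialZigzag q ∧ (∀ i, (q i : ℕ) ≠ m) ∧ m ≤ c := by
  simp only [IsPartialZigzag, Fin.forall_fin_succ', Fin.snoc_castSucc, Fin.snoc_last,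
    Fin.val_castSucc, Fin.val_last, hm, not_true_eq_false, true_implies, false_implies,
    and_true, true_and]
  constructor
  · rintro ⟨h1, h2, h3⟩
    refine ⟨fun i => ⟨(h1 i).1, (h1 i).2.1, (h1 i).2.2.1⟩, fun i hi => ?_, h2⟩
    have h4 := (h1 i).2.2.2 hi
    have h5 := h1 i
    have := i.2
    by_cases he : Even (i : ℕ)
    · have := h4.1 he
      omega
    · have := h5.2.1 he
      omega
  · rintro ⟨h1, h2, h3⟩
    refine ⟨fun i => ⟨(h1 i).1, (h1 i).2.1, (h1 i).2.2, fun h => absurd h (h2 i)⟩, h3, ?_, by omega⟩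
    intro j hj
    have := j.2
    omega

lemma isPartialZigzag_snoc_of_not_even (hm : ¬ Even m) {q : Fin m → Fin N} {c : Fin N} :
    IsPartialZigzag (Fin.snoc q c : Fin (m + 1) → Fin N) ↔
      IsPartialZigzag q ∧ (c : ℕ) ≤ m ∧ (∀ j : Fin m, (j : ℕ) = c → m ≤ q j) ∧
        ∀ i, (q i : ℕ) = m → (c : ℕ) ≤ i := by
  simp only [IsPartialZigzag, Fin.forall_fin_succ', Fin.snoc_castSucc, Fin.snoc_last,
    Fin.val_castSucc, Fin.val_last, hm, not_false_eq_true, true_implies, false_implies,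
    true_and]
  constructor
  · rintro ⟨h1, h2, h3, h4⟩
    refine ⟨fun i => ⟨(h1 i).1, (h1 i).2.1, (h1 i).2.2.1⟩, h2, fun j hj => h3 j hj.symm,
      fun i hi => ?_⟩
    have h5 := (h1 i).2.2.2 hi
    by_cases he : Even (i : ℕ)
    · exact h5.1 he
    · have := (h1 i).2.1 he
      have := i.2
      omega
  · rintro ⟨h1, h2, h3, h4⟩
    refine ⟨fun i => ⟨(h1 i).1, (h1 i).2.1, (h1 i).2.2, fun h => ⟨fun _ => h4 i h, fun he => ?_⟩⟩,
      h2, fun j hj => h3 j hj.symm, fun h => h.ge⟩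
    have := (h1 i).2.1 he
    have := i.2
    omega

lemma card_filter_le_val (m x : ℕ) : #{c : Fin (m + x + 1) | m ≤ (c : ℕ)} = x + 1 := by
  have : ({c : Fin (m + x + 1) | m ≤ (c : ℕ)} : Finset _) = Ici ⟨m, by omega⟩ := by
    ext c
    simp [Fin.le_def]
  rw [this, Fin.card_Ici]
  simp only
  omega

lemma card_filter_lt_val (m x : ℕ) : #{c : Fin (m + x + 1) | m < (c : ℕ)} = x := by
  have : ({c : Fin (m + x + 1) | m < (c : ℕ)} : Finset _) = Ioi ⟨m, by omega⟩ := by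
    ext c
    simp [Fin.lt_def]
  rw [this, Fin.card_Ioi]
  simp only
  omega

lemma card_partialDerangements_succ_of_even (hm : Even m) (x : ℕ) :
    #(partialDerangements (m + 1) (m + x + 1)) = x * #(partialDerangements m (m + x)) := by
  rw [card_eq_sum_snoc (T := partialDerangements m (m + x + 1))
    (R := fun q c => (∀ i, q i ≠ c) ∧ m < c)
    (fun q c => by simp [mem_partialDerangements, isPartialDerangement_snoc, hm])]
  have h1 : x * #(partialDerangements m (m + x)) =
      ∑ c : Fin (m + x + 1), if m < (c : ℕ) then #(partialDerangements m (m + x)) else 0 := by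
    rw [← sum_filter, sum_const, card_filter_lt_val, smul_eq_mul]
  rw [h1]
  refine sum_congr rfl fun c _ => ?_
  split_ifs with hc
  · simp only [hc, and_true]
    exact card_filter_forall_ne c (succAbove_comp_mem_partialDerangements hc.le)
  · simp [hc]

lemma card_partialDerangements_succ_of_not_even (hm : ¬ Even m) (x : ℕ) :
    #(partialDerangements (m + 1) (m + x + 1)) + (x + 1) * #(partialDerangements m (m + x)) =
      (x + 1) * #(partialDerangements m (m + x + 1)) := by
  rw [card_eq_sum_snoc (T := partialDerangements m (m + x + 1))
    (R := fun q c => (∀ i, q i ≠ c) ∧ c < m)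
    (fun q c => by simp [mem_partialDerangements, isPartialDerangement_snoc, hm])]
  have h1 : (x + 1) * #(partialDerangements m (m + x)) =
      ∑ c : Fin (m + x + 1),
        if m ≤ c then #{q ∈ partialDerangements m (m + x + 1) | ∀ i, q i ≠ c} else 0 := by
    rw [← card_filter_le_val m x, card_eq_sum_ones, sum_mul, sum_filter]
    refine sum_congr rfl fun c _ => ?_
    split_ifs with hc
    · rw [one_mul, card_filter_forall_ne c (succAbove_comp_mem_partialDerangements hc)]
    · rfl
  have h2 : (x + 1) * #(partialDerangements m (m + x + 1)) =
      ∑ c : Fin (m + x + 1), #{q ∈ partialDerangements m (m + x + 1) | ∀ i, q i ≠ c} := by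
    have := sum_card_bipartiteAbove_eq_sum_card_bipartiteBelow
      (s := partialDerangements m (m + x + 1)) (t := univ)
      (fun (q : Fin m → Fin (m + x + 1)) c => ∀ i, q i ≠ c)
    simp only [bipartiteBelow] at this
    rw [← this, mul_comm]
    refine (sum_const_nat fun q hq => ?_).symm
    have hinj := (mem_partialDerangements.1 hq).1
    have h3 : bipartiteAbove (fun (q : Fin m → Fin (m + x + 1)) c => ∀ i, q i ≠ c) univ q =
        (univ.image q)ᶜ := by
      ext c
      simp [bipartiteAbove]
    rw [h3, card_compl, card_image_of_injective _ hinj]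
    simp
    omega
  rw [h1, h2, ← sum_add_distrib]
  refine sum_congr rfl fun c _ => ?_
  split_ifs with hc
  · simp [hc.not_gt]
  · simp [lt_of_not_ge hc]

lemma card_partialZigzags_succ_of_even (hm : Even m) (x : ℕ) :
    #(partialZigzags (m + 1) (m + x + 1)) = (x + 1) * #(partialZigzags m (m + x)) := by
  have hM : ∀ a : Fin (m + x + 1), (a : ℕ) ≠ m ↔ a ≠ ⟨m, by omega⟩ := by simp [Fin.ext_iff]
  rw [card_eq_sum_snoc (T := partialZigzags m (m + x + 1))
    (R := fun q c => (∀ i, q i ≠ ⟨m, by omega⟩) ∧ m ≤ c)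
    (fun q c => by simp only [mem_partialZigzags, isPartialZigzag_snoc_of_even hm, hM])]
  rw [← card_filter_le_val m x, card_eq_sum_ones, sum_mul, sum_filter]
  refine sum_congr rfl fun c _ => ?_
  split_ifs with hc
  · simp only [hc, and_true, one_mul]
    exact card_filter_forall_ne _ (succAbove_comp_mem_partialZigzags le_rfl)
  · simp [hc]

lemma IsPartialZigzag.update {q : Fin m → Fin N} (h : IsPartialZigzag q) {w : Fin m} {c : Fin N}
    (hw : m ≤ q w) (hc : m ≤ c) : IsPartialZigzag (Function.update q w c) := by
  have hwe : Even (w : ℕ) := by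
    by_contra he
    have := (h w).2.1 he
    have := w.2
    omega
  intro i
  have hi := i.2
  by_cases hiw : i = w
  · subst hiw
    simp only [Function.update_self]
    refine ⟨fun _ => by omega, fun he => absurd hwe he, fun j hj => ?_⟩
    have := j.2
    omega
  · rw [Function.update_of_ne hiw]
    refine ⟨(h i).1, (h i).2.1, fun j hj => ?_⟩
    have hij := (h i).2.2 j hj
    by_cases hjw : j = w
    · subst hjw
      rw [Function.update_self]
      refine ⟨fun he => ?_, fun _ => by omega⟩
      have := hij.1 he
      omega
    · rwa [Function.update_of_ne hjw]

/-- Changing the undetermined value at `w`. -/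
lemma card_filter_undetermined (x : ℕ) (w : Fin m) :
    #{q ∈ partialZigzags m (m + x + 1) | m ≤ q w ∧ ∀ i, (q i : ℕ) = m → w ≤ i} =
      (x + 1) *
        #{q ∈ partialZigzags m (m + x + 1) | (q w : ℕ) = m ∧ ∀ i, (q i : ℕ) = m → w ≤ i} := by
  rw [card_eq_sum_card_fiberwise (f := fun q => q w)
    (t := ({c : Fin (m + x + 1) | m ≤ (c : ℕ)} : Finset _)) (fun q hq => by simp_all),
    sum_const_nat, card_filter_le_val]
  intro c hc
  replace hc : m ≤ c := by simpa using hc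
  refine card_nbij' (fun q => Function.update q w ⟨m, by omega⟩) (fun q => Function.update q w c)
    ?_ ?_ ?_ ?_
  · intro q hq
    simp only [coe_filter, mem_filter, mem_partialZigzags, Set.mem_ofPred_eq] at hq ⊢
    refine ⟨hq.1.1.update hq.1.2.1 le_rfl, by simp, fun i hi => ?_⟩
    by_cases hiw : i = w
    · exact hiw.ge
    · rw [Function.update_of_ne hiw] at hi
      exact hq.1.2.2 i hi
  · intro q hq
    simp only [coe_filter, mem_filter, mem_partialZigzags, Set.mem_ofPred_eq] at hq ⊢
    refine ⟨⟨hq.1.update hq.2.1.ge hc, by simpa using hc, fun i hi => ?_⟩, by simp⟩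
    by_cases hiw : i = w
    · exact hiw.ge
    · rw [Function.update_of_ne hiw] at hi
      exact hq.2.2 i hi
  · intro q hq
    simp only [coe_filter, mem_filter, Set.mem_ofPred_eq] at hq
    simp [← hq.2]
  · intro q hq
    simp only [coe_filter, Set.mem_ofPred_eq] at hq
    have : (⟨m, by omega⟩ : Fin (m + x + 1)) = q w := Fin.ext hq.2.1.symm
    simp [this]

lemma card_partialZigzags_succ_of_not_even (hm : ¬ Even m) (x : ℕ) :
    #(partialZigzags (m + 1) (m + x + 1)) + x * #(partialZigzags m (m + x)) =
      (x + 1) * #(partialZigzags m (m + x + 1)) := by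
  let d : ℕ → ℕ := fun w =>
    #{q ∈ partialZigzags m (m + x + 1) | ∀ i : Fin m, (q i : ℕ) = m → w ≤ i}
  let a : ℕ → ℕ := fun w => #{q ∈ partialZigzags m (m + x + 1) | w ≤ m ∧
    (∀ j : Fin m, (j : ℕ) = w → m ≤ q j) ∧ ∀ i : Fin m, (q i : ℕ) = m → w ≤ i}
  have hcard : #(partialZigzags (m + 1) (m + x + 1)) = ∑ w ∈ range (m + x + 1), a w := by
    rw [card_eq_sum_snoc (T := partialZigzags m (m + x + 1)) (fun q c => by
      simp only [mem_partialZigzags, isPartialZigzag_snoc_of_not_even hm]; exact Iff.rfl)]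
    rw [← Fin.sum_univ_eq_sum_range a]
    refine sum_congr rfl fun c _ => congrArg card ?_
    ext q
    simp only [mem_filter]
  have htrunc : ∑ w ∈ range (m + x + 1), a w = ∑ w ∈ range (m + 1), a w := by
    refine (sum_subset (range_mono (by omega)) fun w _ hw => ?_).symm
    have : ¬ w ≤ m := by simpa [Nat.lt_succ_iff] using hw
    simp [a, this]
  have ham : a m = d m := by
    refine congrArg card (filter_congr fun q _ => ?_)
    simp only [le_refl, true_and, and_iff_right_iff_imp]
    intro _ j hj
    exact absurd hj j.2.ne
  have hd0 : d 0 = #(partialZigzags m (m + x + 1)) := by simp [d]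
  have hdm : d m = #(partialZigzags m (m + x)) := by
    rw [← card_filter_forall_ne (⟨m, by omega⟩ : Fin (m + x + 1))
      (succAbove_comp_mem_partialZigzags le_rfl)]
    refine congrArg card (filter_congr fun q _ => forall_congr' fun i => ?_)
    rw [Ne, Fin.ext_iff]
    exact imp_congr_right fun _ => iff_of_false (not_le.2 i.2) id
  have hstep : ∀ w, w < m → a w + (x + 1) * d (w + 1) = (x + 1) * d w := by
    intro w hw
    have h1 : a w = #{q ∈ partialZigzags m (m + x + 1) |
        m ≤ q ⟨w, hw⟩ ∧ ∀ i, (q i : ℕ) = m → ⟨w, hw⟩ ≤ i} := by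
      refine congrArg card (filter_congr fun q _ => ?_)
      simp only [hw.le, true_and, Fin.le_def]
      refine and_congr_left fun _ => ⟨fun h => h _ rfl, fun h j hj => ?_⟩
      subst hj
      exact h
    have h2 : d w = #{q ∈ partialZigzags m (m + x + 1) |
        (q ⟨w, hw⟩ : ℕ) = m ∧ ∀ i, (q i : ℕ) = m → ⟨w, hw⟩ ≤ i} + d (w + 1) := by
      simp only [d]
      rw [← card_filter_add_card_filter_not (s := filter _ _)
        (fun q : Fin m → Fin (m + x + 1) => (q ⟨w, hw⟩ : ℕ) = m), filter_filter, filter_filter]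
      congr 1
      · exact congrArg card (filter_congr fun q _ => and_comm)
      · refine congrArg card (filter_congr fun q _ =>
          ⟨fun h i hi => ?_, fun h => ⟨fun i hi => ?_, fun hq => ?_⟩⟩)
        · refine (h.1 i hi).lt_of_ne ?_
          rintro rfl
          exact h.2 hi
        · exact (Nat.le_succ w).trans (h i hi)
        · exact absurd (h _ hq) (Nat.not_succ_le_self w)
    rw [h1, card_filter_undetermined, h2, mul_add]
  have hsum : ∀ k, k ≤ m → ∑ w ∈ range k, a w + (x + 1) * d k = (x + 1) * d 0 := by
    intro k
    induction k with
    | zero => simp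
    | succ k ih =>
      intro hk
      rw [sum_range_succ, add_assoc, hstep k hk, ih (by omega)]
  have := hsum m le_rfl
  rw [hcard, htrunc, sum_range_succ, ham, ← hd0, ← this, ← hdm]
  ring

lemma card_partialZigzags_eq (j x : ℕ) :
    (x + 1) * #(partialZigzags (2 * j) (2 * j + x)) =
      #(partialDerangements (2 * j + 2) (2 * j + 2 + x)) := by
  have hodd : ∀ j, ¬ Even (2 * j + 1) := fun j => by simp
  have hD : ∀ j x, #(partialDerangements (2 * j + 2) (2 * j + 2 + x)) +
      (x + 1) * (x * #(partialDerangements (2 * j) (2 * j + x))) =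
        (x + 1) * ((x + 1) * #(partialDerangements (2 * j) (2 * j + (x + 1)))) := by
    intro j x
    have h1 := card_partialDerangements_succ_of_not_even (hodd j) x
    have h2 := card_partialDerangements_succ_of_even (even_two_mul j) x
    have h3 := card_partialDerangements_succ_of_even (even_two_mul j) (x + 1)
    rw [← h2, ← h3]
    rw [show 2 * j + 2 + x = 2 * j + 1 + x + 1 by omega,
      show 2 * j + x + 1 = 2 * j + 1 + x by omega,
      show 2 * j + (x + 1) + 1 = 2 * j + 1 + x + 1 by omega]
    exact h1
  have hZ : ∀ j x, #(partialZigzags (2 * j + 2) (2 * j + 2 + x)) +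
      x * ((x + 1) * #(partialZigzags (2 * j) (2 * j + x))) =
        (x + 1) * ((x + 2) * #(partialZigzags (2 * j) (2 * j + (x + 1)))) := by
    intro j x
    have h1 := card_partialZigzags_succ_of_not_even (hodd j) x
    have h2 := card_partialZigzags_succ_of_even (even_two_mul j) x
    have h3 := card_partialZigzags_succ_of_even (even_two_mul j) (x + 1)
    rw [← h2, ← h3]
    rw [show 2 * j + 2 + x = 2 * j + 1 + x + 1 by omega,
      show 2 * j + x + 1 = 2 * j + 1 + x by omega,
      show 2 * j + (x + 1) + 1 = 2 * j + 1 + x + 1 by omega]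
    exact h1
  induction j generalizing x with
  | zero =>
    have h1 := hD 0 x
    have h2 : ∀ N, #(partialZigzags 0 N) = 1 := fun N => by
      simp [partialZigzags, IsPartialZigzag]
    have h3 : ∀ N, #(partialDerangements 0 N) = 1 := fun N => by
      simp [partialDerangements, IsPartialDerangement, Function.injective_of_subsingleton]
    simp only [h2, h3] at h1 ⊢
    linarith
  | succ j ih =>
    have h1 := hD (j + 1) x
    have h2 := hZ j x
    have h3 := ih x
    have h4 := ih (x + 1)
    rw [mul_add, mul_one] at h1 ⊢
    have h5 : 2 * j + 2 + (x + 1) = 2 * j + 2 + x + 1 := by ring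
    rw [← h3, ← h4] at h1
    have h6 : (x + 1) * #(partialZigzags (2 * j + 2) (2 * j + 2 + x)) +
      (x + 1) * (x * ((x + 1) * #(partialZigzags (2 * j) (2 * j + x)))) =
        (x + 1) * ((x + 1) * ((x + 2) * #(partialZigzags (2 * j) (2 * j + (x + 1))))) := by
      rw [← h2]; ring
    linarith

end Extension

/-- The increasing bijection between `Fin N` and `[N]`. -/
def finEquivIcc (N : ℕ) : Fin N ≃ {x // x ∈ Finset.Icc 1 N} where
  toFun i := ⟨i + 1, by simp [Finset.mem_Icc]⟩
  invFun i := ⟨i - 1, by have := Finset.mem_Icc.1 i.2; omega⟩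
  left_inv i := by simp
  right_inv i := by
    have := Finset.mem_Icc.1 i.2
    exact Subtype.ext (by simp; omega)

lemma finEquivIcc_val {N : ℕ} (i : Fin N) : (finEquivIcc N i : ℕ) = i + 1 := rfl

open scoped Classical in
lemma card_isZigzag_Icc (N : ℕ) :
    Nat.card {P : {x // x ∈ Finset.Icc 1 N} → {x // x ∈ Finset.Icc 1 N} //
      IsZigzag (fun i : {x // x ∈ Finset.Icc 1 N} => Odd (i : ℕ)) P} = #(partialZigzags N N) := by
  have h : ∀ p : Fin N → Fin N, IsPartialZigzag p ↔
      IsZigzag (fun i : {x // x ∈ Finset.Icc 1 N} => Odd (i : ℕ))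
        ((finEquivIcc N).arrowCongr (finEquivIcc N) p) := by
    intro p
    rw [IsZigzag, ← (finEquivIcc N).forall_congr_right, IsPartialZigzag]
    refine forall_congr' fun i => ?_
    simp only [Equiv.arrowCongr_apply, Function.comp_apply, Equiv.symm_apply_apply,
      ← Subtype.coe_le_coe, finEquivIcc_val, Nat.odd_add_one, Nat.not_odd_iff_even,
      Nat.add_le_add_iff_right, Fin.val_inj, forall_eq']
    tauto
  rw [← Nat.card_congr (((finEquivIcc N).arrowCongr (finEquivIcc N)).subtypeEquiv h),
    Nat.card_eq_fintype_card, Fintype.card_subtype]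
  rfl

lemma isDumontDerangement_iff {N : ℕ} (σ : Equiv.Perm {x // x ∈ Finset.Icc 1 N}) :
    IsDumontDerangement _ σ ↔
      IsPartialDerangement fun i => (finEquivIcc N).symm (σ (finEquivIcc N i)) := by
  have hinj : Function.Injective fun i => (finEquivIcc N).symm (σ (finEquivIcc N i)) :=
    (finEquivIcc N).symm.injective.comp (σ.injective.comp (finEquivIcc N).injective)
  rw [IsDumontDerangement, ← (finEquivIcc N).forall_congr_right, IsPartialDerangement,
    and_iff_right hinj]
  refine forall_congr' fun i => ?_
  have h : (σ (finEquivIcc N i) : ℕ) = (finEquivIcc N).symm (σ (finEquivIcc N i)) + 1 := by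
    rw [← finEquivIcc_val, Equiv.apply_symm_apply]
  simp only [h, finEquivIcc_val, Nat.odd_add_one, Nat.even_add_one, Nat.not_odd_iff_even,
    Nat.add_lt_add_iff_right]
  tauto

lemma medianGenocchi_eq (n : ℕ) :
    medianGenocchi n = #(partialDerangements (2 * n + 2) (2 * n + 2)) := by
  classical
  set e := finEquivIcc (2 * n + 2)
  have hbij : Function.Bijective
      (fun σ : {σ : Equiv.Perm {x // x ∈ Finset.Icc 1 (2 * n + 2)} // IsDumontDerangement _ σ} =>
        (⟨fun i => e.symm (σ.1 (e i)), (isDumontDerangement_iff σ.1).1 σ.2⟩ :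
          {p : Fin (2 * n + 2) → Fin (2 * n + 2) // IsPartialDerangement p})) := by
    refine ⟨fun σ τ h => ?_, fun p => ?_⟩
    · refine Subtype.ext (Equiv.ext fun x => ?_)
      have := congrFun (congrArg Subtype.val h) (e.symm x)
      simpa using this
    · let σ : Equiv.Perm {x // x ∈ Finset.Icc 1 (2 * n + 2)} :=
        e.symm.trans ((Equiv.ofBijective p.1 (Finite.injective_iff_bijective.1 p.2.1)).trans e)
      have hσ : (fun i => e.symm (σ (e i))) = p.1 := by
        funext i
        simp [σ]
      exact ⟨⟨σ, (isDumontDerangement_iff σ).2 (hσ ▸ p.2)⟩, Subtype.ext hσ⟩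
  rw [medianGenocchi, Nat.card_congr (Equiv.ofBijective _ hbij), Nat.card_eq_fintype_card,
    Fintype.card_subtype]
  rfl

/-- The number of ID forests with vertex set `[2n]` is the median Genocchi number `h_n`,
the number of Dumont derangements on `[2n+2]`. -/
theorem stmt4 (n : ℕ) (hn : 1 ≤ n) :
    Nat.card {F : SimpleGraph {x // x ∈ Finset.Icc 1 (2 * n)} //
        IsIDForest (Finset.Icc 1 (2 * n)) F} = medianGenocchi n := by
  rw [card_isIDForest, card_isZigzag_Icc, medianGenocchi_eq]
  simpa using card_partialZigzags_eq n 0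
end

section
/- For all n ≥ 1, the number of D-permutations on [2n] equals the median Genocchi number h_n, i.e., the number of permutations σ of [2n] satisfying σ(i) ≥ i for all odd i and σ(i) ≤ i for all even i equals the number of Dumont derangements on [2n+2]. -/
open Finset

/-- Permutations of a finite set satisfying a pointwise relation are the permutations of `ℕ`
that fix the complement and satisfy the relation on the set. -/
lemma card_perm_pointwise (A : Finset ℕ) (R : ℕ → ℕ → Prop) :
    Nat.card {σ : Equiv.Perm {x // x ∈ A} // ∀ i : {x // x ∈ A}, R i (σ i)} =
      Nat.card {f : Equiv.Perm ℕ // (∀ i, i ∉ A → f i = i) ∧ ∀ i ∈ A, R i (f i)} := by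
  classical
  refine Nat.card_congr (((Equiv.Perm.subtypeEquivSubtypePerm (· ∈ A)).subtypeEquiv
    (q := fun f => ∀ i ∈ A, R i (f.1 i)) fun σ => ?_).trans
    (Equiv.subtypeSubtypeEquivSubtypeInter _ fun f : Equiv.Perm ℕ => ∀ i ∈ A, R i (f i)))
  constructor
  · intro h i hi
    simpa [Equiv.Perm.subtypeEquivSubtypePerm, Equiv.Perm.ofSubtype_apply_of_mem σ hi]
      using h ⟨i, hi⟩
  · intro h i
    simpa [Equiv.Perm.subtypeEquivSubtypePerm] using h i i.2

/-- A permutation fixing the complement of a set maps the set to itself. -/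
lemma perm_apply_mem {A : Finset ℕ} {f : Equiv.Perm ℕ} (h : ∀ i, i ∉ A → f i = i) {i : ℕ}
    (hi : i ∈ A) : f i ∈ A := by
  by_contra hf
  exact hf (by rwa [f.injective (h _ hf)])

/-- The cyclic shift `0 ↦ 1 ↦ ⋯ ↦ m ↦ 0`, fixing everything above `m`. -/
def cyclicShift (m : ℕ) : Equiv.Perm ℕ where
  toFun i := if i < m then i + 1 else if i = m then 0 else i
  invFun i := if i = 0 then m else if i ≤ m then i - 1 else i
  left_inv i := by grind
  right_inv i := by grind

/-- The involution exchanging `2i - 1` and `2i` for `1 ≤ i ≤ m`. -/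
def pairSwap (m : ℕ) : Equiv.Perm ℕ where
  toFun i := if i = 0 ∨ 2 * m < i then i else if i % 2 = 0 then i - 1 else i + 1
  invFun i := if i = 0 ∨ 2 * m < i then i else if i % 2 = 0 then i - 1 else i + 1
  left_inv i := by grind
  right_inv i := by grind

lemma cyclicShift_apply (m i : ℕ) :
    cyclicShift m i = if i < m then i + 1 else if i = m then 0 else i := rfl

lemma cyclicShift_symm_apply (m i : ℕ) :
    (cyclicShift m).symm i = if i = 0 then m else if i ≤ m then i - 1 else i := rfl

lemma pairSwap_apply (m i : ℕ) : pairSwap m i =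
    if i = 0 ∨ 2 * m < i then i else if i % 2 = 0 then i - 1 else i + 1 := rfl

/-- Conjugation by the shift followed by precomposition with the pair swap. -/
def shiftSwap (n : ℕ) : Equiv.Perm ℕ ≃ Equiv.Perm ℕ :=
  Equiv.equivCongr ((cyclicShift (2 * n + 1)).trans (pairSwap (n + 1))) (cyclicShift (2 * n + 1))

lemma shiftSwap_apply (n : ℕ) (f : Equiv.Perm ℕ) (i : ℕ) : shiftSwap n f i =
    cyclicShift (2 * n + 1) (f ((cyclicShift (2 * n + 1)).symm (pairSwap (n + 1) i))) := rfl

lemma shiftSwap_symm_apply (n : ℕ) (g : Equiv.Perm ℕ) (i : ℕ) : (shiftSwap n).symm g i =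
    (cyclicShift (2 * n + 1)).symm (g (pairSwap (n + 1) (cyclicShift (2 * n + 1) i))) := rfl

lemma shiftSwap_dumont {n : ℕ} {f : Equiv.Perm ℕ} (hfix : ∀ i, i ∉ Icc 1 (2 * n) → f i = i)
    (hf : ∀ i ∈ Icc 1 (2 * n), (Odd i → i ≤ f i) ∧ (Even i → f i ≤ i)) :
    (∀ i, i ∉ Icc 1 (2 * n + 2) → shiftSwap n f i = i) ∧
      ∀ i ∈ Icc 1 (2 * n + 2),
        (Even i → shiftSwap n f i < i) ∧ (Odd i → i < shiftSwap n f i) := by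
  have hmem := fun i => perm_apply_mem hfix (i := i)
  simp only [mem_Icc, Nat.odd_iff, Nat.even_iff] at *
  refine ⟨fun i hi => ?_, fun i hi => ?_⟩
  all_goals
    rw [shiftSwap_apply]
    generalize hk : pairSwap (n + 1) i = k
    generalize hj : (cyclicShift (2 * n + 1)).symm k = j
    have h1 := hfix j
    have h2 := hf j
    have h3 := hmem j
    rw [cyclicShift_symm_apply] at hj
    rw [pairSwap_apply] at hk
    rw [cyclicShift_apply]
    split_ifs at hj hk ⊢ <;> omega

lemma shiftSwap_symm_dperm {n : ℕ} {g : Equiv.Perm ℕ}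
    (hfix : ∀ i, i ∉ Icc 1 (2 * n + 2) → g i = i)
    (hg : ∀ i ∈ Icc 1 (2 * n + 2), (Even i → g i < i) ∧ (Odd i → i < g i)) :
    (∀ i, i ∉ Icc 1 (2 * n) → (shiftSwap n).symm g i = i) ∧
      ∀ i ∈ Icc 1 (2 * n),
        (Odd i → i ≤ (shiftSwap n).symm g i) ∧ (Even i → (shiftSwap n).symm g i ≤ i) := by
  have hmem := fun i => perm_apply_mem hfix (i := i)
  simp only [mem_Icc, Nat.odd_iff, Nat.even_iff] at *
  refine ⟨fun i hi => ?_, fun i hi => ?_⟩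
  all_goals
    rw [shiftSwap_symm_apply]
    generalize hk : cyclicShift (2 * n + 1) i = k
    generalize hj : pairSwap (n + 1) k = j
    have h1 := hfix j
    have h2 := hg j
    have h3 := hmem j
    rw [pairSwap_apply] at hj
    rw [cyclicShift_apply] at hk
    rw [cyclicShift_symm_apply]
    split_ifs at hj hk ⊢ <;> omega

/-- The number of D-permutations on `[2n]` is the median Genocchi number `h_n`,
the number of Dumont derangements on `[2n+2]`. -/
theorem stmt6 (n : ℕ) (hn : 1 ≤ n) :
    Nat.card {σ : Equiv.Perm {x // x ∈ Finset.Icc 1 (2 * n)} //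
        IsDPerm (Finset.Icc 1 (2 * n)) σ} = medianGenocchi n := by
  refine (card_perm_pointwise (Icc 1 (2 * n)) fun i j => (Odd i → i ≤ j) ∧ (Even i → j ≤ i)).trans
    (Eq.trans (Nat.card_congr ((shiftSwap n).subtypeEquiv fun f => ?_))
      (card_perm_pointwise (Icc 1 (2 * n + 2))
        fun i j => (Even i → j < i) ∧ (Odd i → i < j)).symm)
  refine ⟨fun h => shiftSwap_dumont h.1 h.2, fun h => ?_⟩
  simpa only [Equiv.symm_apply_apply] using shiftSwap_symm_dperm h.1 h.2
end
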